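/- arXiv:1605.07995 — 10 statements merged into one kernel-verified Lean document; each statement's English description precedes it below -/
import Mathlib

section
/- Let U ⊆ ℂ be open, let p : ℂ → ℂ be differentiable on U, let Φ : ℂ → ℂ be three times differentiable on U, and let β, γ ∈ ℂ. Suppose that for all x ∈ U: (i) Φ''(x) = 2·p(x)·Φ(x) + β·Φ(x) (the Lamé equation), and (ii) 2·(p(x) − β)·Φ'(x) = (p'(x) + γ)·Φ(x). Then for all x ∈ U: Φ(x)·Φ'''(x) − 3·Φ'(x)·Φ''(x) = −6·β·Φ(x)·Φ'(x) − 2·γ·Φ(x)². -/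
/-- Lemma 1 of the paper: if `Φ` satisfies the Lamé equation
`Φ'' = 2 p Φ + β Φ` and the logarithmic-derivative relation
`2 (p - β) Φ' = (p' + γ) Φ` on an open set `U`, then
`Φ Φ''' - 3 Φ' Φ'' = -6 β Φ Φ' - 2 γ Φ²` on `U`. -/
theorem elliptic_level4_lemma1
    (U : Set ℂ) (hU : IsOpen U) (p Φ : ℂ → ℂ) (β γ : ℂ)
    (hp : DifferentiableOn ℂ p U)
    (hΦ : DifferentiableOn ℂ Φ U)
    (hΦ' : DifferentiableOn ℂ (deriv Φ) U)
    (hΦ'' : DifferentiableOn ℂ (deriv (deriv Φ)) U)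
    (hLame : ∀ x ∈ U, deriv (deriv Φ) x = 2 * p x * Φ x + β * Φ x)
    (hlog : ∀ x ∈ U, 2 * (p x - β) * deriv Φ x = (deriv p x + γ) * Φ x) :
    ∀ x ∈ U,
      Φ x * deriv (deriv (deriv Φ)) x - 3 * deriv Φ x * deriv (deriv Φ) x
        = -6 * β * Φ x * deriv Φ x - 2 * γ * (Φ x) ^ 2 := by
  intro x hx
  have hxU : U ∈ nhds x := hU.mem_nhds hx
  have hdp := (hp.differentiableAt hxU).hasDerivAt
  have hdΦ := (hΦ.differentiableAt hxU).hasDerivAt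
  have hΦ''' : deriv (deriv (deriv Φ)) x
      = 2 * deriv p x * Φ x + 2 * p x * deriv Φ x + β * deriv Φ x := by
    have hev : deriv (deriv Φ) =ᶠ[nhds x] fun y => 2 * p y * Φ y + β * Φ y :=
      Filter.eventually_of_mem hxU hLame
    rw [hev.deriv_eq]
    exact (((hdp.const_mul 2).mul hdΦ).add (hdΦ.const_mul β)).deriv
  linear_combination Φ x * hΦ''' - 3 * deriv Φ x * hLame x hx - 2 * Φ x * hlog x hx
end

section
/- Let U ⊆ ℂ be open, let Φ : ℂ → ℂ be three times differentiable and nonvanishing on U, and let α, β, γ ∈ ℂ. Suppose that for all x ∈ U: Φ(x)·Φ'''(x) − 3·Φ'(x)·Φ''(x) = −6·β·Φ(x)·Φ'(x) − 2·γ·Φ(x)². Define f : U → ℂ by f(x) = exp(α·x)/Φ(x). Then f is three times differentiable on U and for all x ∈ U: f(x)·f'''(x) − 3·f'(x)·f''(x) = C₁·f'(x)² + C₂·f(x)·f'(x) + C₃·f(x)², where C₁ = −6α, C₂ = 6α² − 6β, C₃ = 2γ + 6αβ − 2α³. -/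
/-- For a nonvanishing holomorphic function `f` with logarithmic derivative `g`,
`f f''' - 3 f' f'' = f² (g'' - 2 g³)`. -/
theorem mul_deriv_three_sub_eq_logDeriv {U : Set ℂ} (hU : IsOpen U) {f : ℂ → ℂ}
    (hf : DifferentiableOn ℂ f U) (hne : ∀ x ∈ U, f x ≠ 0) {x : ℂ} (hx : x ∈ U) :
    f x * deriv (deriv (deriv f)) x - 3 * deriv f x * deriv (deriv f) x
      = f x ^ 2 * (deriv (deriv (logDeriv f)) x - 2 * logDeriv f x ^ 3) := by
  set g := logDeriv f with hg
  have hgd : DifferentiableOn ℂ g U := (hf.deriv hU).div hf hne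
  have hf1 : ∀ y ∈ U, HasDerivAt f (f y * g y) y := fun y hy => by
    have h : f y * g y = deriv f y := by rw [hg, logDeriv_apply, mul_div_cancel₀ _ (hne y hy)]
    rw [h]
    exact (hf.differentiableAt (hU.mem_nhds hy)).hasDerivAt
  have hg1 : ∀ y ∈ U, HasDerivAt g (deriv g y) y := fun y hy =>
    (hgd.differentiableAt (hU.mem_nhds hy)).hasDerivAt
  have hg2 : ∀ y ∈ U, HasDerivAt (deriv g) (deriv (deriv g) y) y := fun y hy =>
    ((hgd.deriv hU).differentiableAt (hU.mem_nhds hy)).hasDerivAt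
  have e1 : Set.EqOn (deriv f) (f * g) U := fun y hy => (hf1 y hy).deriv
  have e2 : Set.EqOn (deriv (deriv f)) (f * g * g + f * deriv g) U := fun y hy =>
    (e1.deriv hU hy).trans ((hf1 y hy).mul (hg1 y hy)).deriv
  have e3 := (e2.deriv hU hx).trans
    ((((hf1 x hx).mul (hg1 x hx)).mul (hg1 x hx)).add ((hf1 x hx).mul (hg2 x hx))).deriv
  rw [e3, e2 hx, e1 hx]
  simp only [Pi.mul_apply, Pi.add_apply]
  ring

/-- Corollary to Lemma 1 of the paper: if `Φ` is three times differentiable and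
nonvanishing on an open set `U` and satisfies
`Φ Φ''' - 3 Φ' Φ'' = -6 β Φ Φ' - 2 γ Φ²`, then `f(x) = exp(α x)/Φ(x)` is three
times differentiable on `U` and satisfies equation (feq):
`f f''' - 3 f' f'' = C₁ (f')² + C₂ f f' + C₃ f²` with
`C₁ = -6α`, `C₂ = 6α² - 6β`, `C₃ = 2γ + 6αβ - 2α³`. -/
theorem elliptic_level4_corollary_Kr
    (U : Set ℂ) (hU : IsOpen U) (Φ : ℂ → ℂ) (α β γ : ℂ)
    (hΦ : DifferentiableOn ℂ Φ U)
    (hΦ' : DifferentiableOn ℂ (deriv Φ) U)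
    (hΦ'' : DifferentiableOn ℂ (deriv (deriv Φ)) U)
    (hne : ∀ x ∈ U, Φ x ≠ 0)
    (heq : ∀ x ∈ U,
      Φ x * deriv (deriv (deriv Φ)) x - 3 * deriv Φ x * deriv (deriv Φ) x
        = -6 * β * Φ x * deriv Φ x - 2 * γ * (Φ x) ^ 2)
    (f : ℂ → ℂ) (hf : ∀ x, f x = Complex.exp (α * x) / Φ x) :
    (DifferentiableOn ℂ f U ∧ DifferentiableOn ℂ (deriv f) U ∧
      DifferentiableOn ℂ (deriv (deriv f)) U) ∧
    ∀ x ∈ U,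
      f x * deriv (deriv (deriv f)) x - 3 * deriv f x * deriv (deriv f) x
        = (-6 * α) * (deriv f x) ^ 2 + (6 * α ^ 2 - 6 * β) * f x * deriv f x
          + (2 * γ + 6 * α * β - 2 * α ^ 3) * (f x) ^ 2 := by
  obtain rfl : f = fun x => Complex.exp (α * x) / Φ x := funext hf
  set f : ℂ → ℂ := fun x => Complex.exp (α * x) / Φ x
  have hfne : ∀ x ∈ U, f x ≠ 0 := fun x hx => div_ne_zero (Complex.exp_ne_zero _) (hne x hx)
  have hexp : Differentiable ℂ fun x : ℂ => Complex.exp (α * x) := by fun_prop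
  have hfd : DifferentiableOn ℂ f U := hexp.differentiableOn.div hΦ hne
  refine ⟨⟨hfd, hfd.deriv hU, (hfd.deriv hU).deriv hU⟩, fun x hx => ?_⟩
  have hlog : Set.EqOn (logDeriv f) (fun y => α - logDeriv Φ y) U := fun y hy => by
    have hd : HasDerivAt (fun x : ℂ => Complex.exp (α * x)) (Complex.exp (α * y) * (α * 1)) y :=
      ((hasDerivAt_id y).const_mul α).cexp
    change logDeriv (fun x => Complex.exp (α * x) / Φ x) y = _
    rw [logDeriv_div (f := fun x => Complex.exp (α * x)) y (Complex.exp_ne_zero _) (hne y hy) (hexp y)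
      (hΦ.differentiableAt (hU.mem_nhds hy)), logDeriv_apply, hd.deriv,
      mul_div_cancel_left₀ _ (Complex.exp_ne_zero _), mul_one]
  have hlog2 : deriv (deriv (logDeriv f)) x = -deriv (deriv (logDeriv Φ)) x := by
    rw [(hlog.deriv hU).deriv hU hx]
    have h : deriv (fun y => α - logDeriv Φ y) = fun y => -deriv (logDeriv Φ) y :=
      funext fun _ => deriv_const_sub α
    rw [h, deriv.fun_neg]
  have hΦx : deriv Φ x = Φ x * logDeriv Φ x := by
    rw [logDeriv_apply, mul_div_cancel₀ _ (hne x hx)]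
  have hfx : deriv f x = f x * (α - logDeriv Φ x) := by
    rw [← show logDeriv f x = α - logDeriv Φ x from hlog hx, logDeriv_apply, mul_div_cancel₀ _ (hfne x hx)]
  have hΦ3 := heq x hx
  rw [mul_deriv_three_sub_eq_logDeriv hU hΦ hne hx, hΦx] at hΦ3
  have key : deriv (deriv (logDeriv Φ)) x - 2 * logDeriv Φ x ^ 3
      = -6 * β * logDeriv Φ x - 2 * γ :=
    mul_left_cancel₀ (pow_ne_zero 2 (hne x hx)) (hΦ3.trans (by ring))
  rw [mul_deriv_three_sub_eq_logDeriv hU hfd hfne hx, hlog2, hlog hx, hfx]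
  linear_combination -f x ^ 2 * key
end

section
/- Let A, B : ℂ → ℂ be analytic on a ball B(0,ρ) with A(0) = B(0) = 1, B'(0) = 0, A''(0) = 0, and set A₁ = A'(0), B₂ = B''(0)/2. Let f : ℂ → ℂ be analytic on a ball B(0,r) with f(0) = 0, f'(0) = 1, with image of B(0,r/2) contained in B(0,ρ), and suppose the addition law of the Buchstaber formal group holds in cleared-denominator form: for all x, y ∈ B(0,r/2) with x + y ∈ B(0,r), f(x+y)·( f(x)·B(f(y)) − f(y)·B(f(x)) ) = f(x)²·A(f(y)) − f(y)²·A(f(x)). Then for all x in some neighborhood of 0: B(f(x)) = f'(x) − A₁·f(x), and 2·A(f(x)) = 2·f'(x)² − f(x)·f''(x) − A₁·f(x)·f'(x) − 2·B₂·f(x)². -/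
open Metric in
/-- The derivative in `y` of the cleared-denominator addition law, with `x` fixed. -/
theorem buchstaber_addition_law_deriv {A B f : ℂ → ℂ} {ρ r : ℝ}
    (hA : AnalyticOnNhd ℂ A (ball 0 ρ)) (hB : AnalyticOnNhd ℂ B (ball 0 ρ))
    (hf : AnalyticOnNhd ℂ f (ball 0 r))
    (hmaps : Set.MapsTo f (ball 0 (r / 2)) (ball 0 ρ))
    (hadd : ∀ x ∈ ball (0 : ℂ) (r / 2), ∀ y ∈ ball (0 : ℂ) (r / 2),
      x + y ∈ ball (0 : ℂ) r →
      f (x + y) * (f x * B (f y) - f y * B (f x))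
        = (f x) ^ 2 * A (f y) - (f y) ^ 2 * A (f x))
    {x y : ℂ} (hx : x ∈ ball (0 : ℂ) (r / 2)) (hy : y ∈ ball (0 : ℂ) (r / 2)) :
    deriv f (x + y) * (f x * B (f y) - f y * B (f x))
        + f (x + y) * (f x * (deriv B (f y) * deriv f y) - deriv f y * B (f x))
      = f x ^ 2 * (deriv A (f y) * deriv f y) - 2 * f y * deriv f y * A (f x) := by
  have hsum : ∀ z ∈ ball (0 : ℂ) (r / 2), x + z ∈ ball (0 : ℂ) r := by
    intro z hz
    rw [mem_ball_zero_iff] at *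
    linarith [norm_add_le x z]
  have hyr : y ∈ ball (0 : ℂ) r := by
    rw [mem_ball_zero_iff] at *
    linarith [norm_nonneg y]
  have dfy := (hf y hyr).differentiableAt.hasDerivAt
  have dfxy := (hf _ (hsum y hy)).differentiableAt.hasDerivAt.comp_const_add x y
  have dBf := (hB _ (hmaps hy)).differentiableAt.hasDerivAt.comp y dfy
  have dAf := (hA _ (hmaps hy)).differentiableAt.hasDerivAt.comp y dfy
  have dL := dfxy.mul ((dBf.const_mul (f x)).sub (dfy.mul_const (B (f x))))
  have dR := (dAf.const_mul (f x ^ 2)).sub ((dfy.pow 2).mul_const (A (f x)))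
  have hev := (isOpen_ball.eventually_mem hy).mono fun z hz => hadd x hx z hz (hsum z hz)
  have h := dL.unique (dR.congr_of_eventuallyEq hev)
  simp only [Function.comp_apply, Nat.cast_ofNat, Nat.add_one_sub_one, pow_one,
    Pi.sub_apply] at h
  exact h

open Metric in
/-- The second derivative in `y` at `y = 0` of the cleared-denominator addition law, with `x`
fixed. -/
theorem buchstaber_addition_law_deriv_deriv_zero {A B f : ℂ → ℂ} {ρ r : ℝ}
    (hA : AnalyticOnNhd ℂ A (ball 0 ρ)) (hB : AnalyticOnNhd ℂ B (ball 0 ρ))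
    (hB0 : B 0 = 1) (hB'0 : deriv B 0 = 0) (hA''0 : deriv (deriv A) 0 = 0)
    (hf : AnalyticOnNhd ℂ f (ball 0 r)) (hf0 : f 0 = 0) (hf'0 : deriv f 0 = 1)
    (hmaps : Set.MapsTo f (ball 0 (r / 2)) (ball 0 ρ))
    (hadd : ∀ x ∈ ball (0 : ℂ) (r / 2), ∀ y ∈ ball (0 : ℂ) (r / 2),
      x + y ∈ ball (0 : ℂ) r →
      f (x + y) * (f x * B (f y) - f y * B (f x))
        = (f x) ^ 2 * A (f y) - (f y) ^ 2 * A (f x))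
    {x : ℂ} (hx : x ∈ ball (0 : ℂ) (r / 2)) :
    deriv (deriv f) x * f x - 2 * deriv f x * B (f x)
        + f x * (f x * deriv (deriv B) 0 - deriv (deriv f) 0 * B (f x))
      = f x ^ 2 * (deriv A 0 * deriv (deriv f) 0) - 2 * A (f x) := by
  have hr : 0 < r / 2 := pos_of_mem_ball hx
  have h0 : (0 : ℂ) ∈ ball (0 : ℂ) (r / 2) := mem_ball_self hr
  have h0r : (0 : ℂ) ∈ ball (0 : ℂ) r := mem_ball_self (by linarith)
  have hxr : x + 0 ∈ ball (0 : ℂ) r := by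
    rw [add_zero]
    exact ball_subset_ball (by linarith) hx
  have df := (hf 0 h0r).differentiableAt.hasDerivAt
  have ddf := (hf 0 h0r).deriv.differentiableAt.hasDerivAt
  have dfx := (hf _ hxr).differentiableAt.hasDerivAt.comp_const_add x 0
  have ddfx := (hf _ hxr).deriv.differentiableAt.hasDerivAt.comp_const_add x 0
  have dB := (hB _ (hmaps h0)).differentiableAt.hasDerivAt.comp 0 df
  have ddB := (hB _ (hmaps h0)).deriv.differentiableAt.hasDerivAt.comp 0 df
  have ddA := (hA _ (hmaps h0)).deriv.differentiableAt.hasDerivAt.comp 0 df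
  have dL := (ddfx.mul ((dB.const_mul (f x)).sub (df.mul_const (B (f x))))).add
    (dfx.mul (((ddB.mul ddf).const_mul (f x)).sub (ddf.mul_const (B (f x)))))
  have dR := ((ddA.mul ddf).const_mul (f x ^ 2)).sub
    (((df.const_mul 2).mul ddf).mul_const (A (f x)))
  have hev := (isOpen_ball.eventually_mem h0).mono fun y hy =>
    buchstaber_addition_law_deriv hA hB hf hmaps hadd hx hy
  have h := dL.unique (dR.congr_of_eventuallyEq hev)
  simp only [Function.comp_apply, Pi.sub_apply, Pi.mul_apply, add_zero, hf0, hf'0, hB0, hB'0,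
    hA''0] at h
  linear_combination h


/-- Lemma 6 of the paper (relations (AB)): if `f` is the exponential of the
Buchstaber formal group `F(u,v) = (u²A(v) - v²A(u))/(uB(v) - vB(u))`
(with the addition law stated in cleared-denominator form), then near `0`:
`B(f(x)) = f'(x) - A₁ f(x)` and
`2 A(f(x)) = 2 f'(x)² - f(x) f''(x) - A₁ f(x) f'(x) - 2 B₂ f(x)²`. -/
theorem elliptic_level4_AB_relations
    (A B f : ℂ → ℂ) (ρ r : ℝ) (hρ : 0 < ρ) (hr : 0 < r) (A₁ B₂ : ℂ)
    (hA : AnalyticOnNhd ℂ A (Metric.ball 0 ρ))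
    (hB : AnalyticOnNhd ℂ B (Metric.ball 0 ρ))
    (hA0 : A 0 = 1) (hB0 : B 0 = 1)
    (hB'0 : deriv B 0 = 0) (hA''0 : iteratedDeriv 2 A 0 = 0)
    (hA₁ : A₁ = deriv A 0) (hB₂ : B₂ = iteratedDeriv 2 B 0 / 2)
    (hf : AnalyticOnNhd ℂ f (Metric.ball 0 r))
    (hf0 : f 0 = 0) (hf'0 : deriv f 0 = 1)
    (hmaps : Set.MapsTo f (Metric.ball 0 (r / 2)) (Metric.ball 0 ρ))
    (hadd : ∀ x ∈ Metric.ball (0 : ℂ) (r / 2), ∀ y ∈ Metric.ball (0 : ℂ) (r / 2),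
      x + y ∈ Metric.ball (0 : ℂ) r →
      f (x + y) * (f x * B (f y) - f y * B (f x))
        = (f x) ^ 2 * A (f y) - (f y) ^ 2 * A (f x)) :
    ∃ ε > 0, ∀ x ∈ Metric.ball (0 : ℂ) ε,
      B (f x) = deriv f x - A₁ * f x ∧
      2 * A (f x) = 2 * (deriv f x) ^ 2 - f x * deriv (deriv f) x
        - A₁ * f x * deriv f x - 2 * B₂ * (f x) ^ 2 := by
  rw [iteratedDeriv_succ, iteratedDeriv_one] at hA''0 hB₂
  have hr2 : 0 < r / 2 := by linarith
  have h0 : (0 : ℂ) ∈ Metric.ball (0 : ℂ) (r / 2) := Metric.mem_ball_self hr2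
  have hf_an : AnalyticAt ℂ f 0 := hf 0 (Metric.mem_ball_self hr)
  have df : HasDerivAt f 1 0 := hf'0 ▸ hf_an.differentiableAt.hasDerivAt
  have hne : ∀ᶠ x in nhds (0 : ℂ), x ≠ 0 → f x ≠ 0 := by
    have h := df.eventually_ne one_ne_zero (c := 0)
    rwa [eventually_nhdsWithin_iff] at h
  obtain ⟨δ, hδ, hne⟩ := Metric.eventually_nhds_iff_ball.mp hne
  have hBf : ∀ x ∈ Metric.ball (0 : ℂ) (min δ (r / 2)), B (f x) = deriv f x - A₁ * f x := by
    intro x hx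
    by_cases hx0 : x = 0
    · simp [hx0, hf0, hB0, hf'0]
    have hfx := hne x (Metric.ball_subset_ball (min_le_left _ _) hx) hx0
    have h := buchstaber_addition_law_deriv hA hB hf hmaps hadd
      (Metric.ball_subset_ball (min_le_right _ _) hx) h0
    simp only [add_zero, hf0, hf'0, hB0, hB'0, ← hA₁] at h
    apply mul_left_cancel₀ hfx
    linear_combination -h
  have hε : 0 < min δ (r / 2) := lt_min hδ hr2
  have hf''0 : deriv (deriv f) 0 = A₁ := by
    have dB := (hB _ (hmaps h0)).differentiableAt.hasDerivAt.comp 0 df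
    have dR := hf_an.deriv.differentiableAt.hasDerivAt.sub (df.const_mul A₁)
    have h := dB.unique (dR.congr_of_eventuallyEq
      ((Metric.isOpen_ball.eventually_mem (Metric.mem_ball_self hε)).mono hBf))
    rw [hf0, hB'0] at h
    linear_combination -h
  refine ⟨_, hε, fun x hx => ⟨hBf x hx, ?_⟩⟩
  have h := buchstaber_addition_law_deriv_deriv_zero hA hB hB0 hB'0 hA''0 hf hf0 hf'0 hmaps hadd
    (Metric.ball_subset_ball (min_le_right _ _) hx)
  rw [hBf x hx, hf''0, ← hA₁] at h
  rw [hB₂]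
  linear_combination h
end

section
/- Let A, B : ℂ → ℂ be analytic on a ball B(0,ρ) with A(0) = B(0) = 1, B'(0) = 0, A''(0) = 0, and set A₁ = A'(0), B₂ = B''(0)/2, A₃ = A'''(0)/6, B₃ = B'''(0)/6. Let f : ℂ → ℂ be analytic on a ball B(0,r) with f(0) = 0, f'(0) = 1, with image of B(0,r/2) contained in B(0,ρ), and suppose that for all x, y ∈ B(0,r/2) with x + y ∈ B(0,r): f(x+y)·( f(x)·B(f(y)) − f(y)·B(f(x)) ) = f(x)²·A(f(y)) − f(y)²·A(f(x)). Then for all x in some neighborhood of 0: f(x)·f'''(x) − 3·f'(x)·f''(x) = C₁·f'(x)² + C₂·f(x)·f'(x) + C₃·f(x)², where C₁ = −3A₁, C₂ = A₁² − 4B₂, C₃ = 6(A₃ − B₃). -/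
open Filter Topology

/-- `HasCubicJet g a b c d` says that `g y = a + b y + c y² + d y³ + y⁴ h y` for some `h`
continuous at `0`. -/
def HasCubicJet (g : ℂ → ℂ) (a b c d : ℂ) : Prop :=
  ∃ h : ℂ → ℂ, ContinuousAt h 0 ∧ ∀ y, g y = a + b * y + c * y ^ 2 + d * y ^ 3 + y ^ 4 * h y

/-- The cubic Taylor expansion of an analytic function. -/
theorem AnalyticAt.hasCubicJet {g : ℂ → ℂ} {x : ℂ} (hg : AnalyticAt ℂ g x) :
    HasCubicJet (fun y => g (x + y)) (g x) (deriv g x) (iteratedDeriv 2 g x / 2)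
      (iteratedDeriv 3 g x / 6) := by
  have hg' : AnalyticAt ℂ (fun y => g (x + y)) 0 :=
    AnalyticAt.fun_comp (by simpa using hg) (by fun_prop)
  obtain ⟨F, hF, h⟩ := hg'.exists_eq_sum_add_pow_mul 4
  refine ⟨F, hF.continuousAt, fun y => ?_⟩
  refine (h y).trans ?_
  simp only [iteratedDeriv_comp_const_add, Finset.sum_range_succ, Finset.sum_range_zero,
    smul_eq_mul, add_zero, iteratedDeriv_zero, iteratedDeriv_one, Nat.factorial]
  push_cast
  ring

namespace HasCubicJet

variable {g g' : ℂ → ℂ} {a b c d a' b' c' d' : ℂ}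

theorem congr_coeff (hg : HasCubicJet g a b c d) (ha : a = a') (hb : b = b') (hc : c = c')
    (hd : d = d') : HasCubicJet g a' b' c' d' := by
  subst ha hb hc hd
  exact hg

theorem const (k : ℂ) : HasCubicJet (fun _ => k) k 0 0 0 :=
  ⟨fun _ => 0, continuousAt_const, fun y => by ring⟩

theorem add (hg : HasCubicJet g a b c d) (hg' : HasCubicJet g' a' b' c' d') :
    HasCubicJet (fun y => g y + g' y) (a + a') (b + b') (c + c') (d + d') := by
  obtain ⟨h, hc, h⟩ := hg
  obtain ⟨h', hc', h'⟩ := hg'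
  exact ⟨_, hc.add hc', fun y => by simp only [h, h', Pi.add_apply]; ring⟩

theorem mul (hg : HasCubicJet g a b c d) (hg' : HasCubicJet g' a' b' c' d') :
    HasCubicJet (fun y => g y * g' y) (a * a') (a * b' + b * a') (a * c' + b * b' + c * a')
      (a * d' + b * c' + c * b' + d * a') := by
  obtain ⟨h, hc, hh⟩ := hg
  obtain ⟨h', hc', hh'⟩ := hg'
  refine ⟨fun y => (b * d' + c * c' + d * b') + (c * d' + d * c') * y + d * d' * y ^ 2
    + h y * (a' + b' * y + c' * y ^ 2 + d' * y ^ 3)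
    + h' y * (a + b * y + c * y ^ 2 + d * y ^ 3) + y ^ 4 * h y * h' y, by fun_prop, fun y => ?_⟩
  simp only [hh, hh']
  ring

theorem neg (hg : HasCubicJet g a b c d) :
    HasCubicJet (fun y => - g y) (-a) (-b) (-c) (-d) := by
  obtain ⟨h, hc, h⟩ := hg
  exact ⟨_, hc.neg, fun y => by simp only [h, Pi.neg_apply]; ring⟩

theorem sub (hg : HasCubicJet g a b c d) (hg' : HasCubicJet g' a' b' c' d') :
    HasCubicJet (fun y => g y - g' y) (a - a') (b - b') (c - c') (d - d') := by
  simpa only [sub_eq_add_neg] using hg.add hg'.neg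

protected theorem continuousAt (hg : HasCubicJet g a b c d) : ContinuousAt g 0 := by
  obtain ⟨h, hc, hh⟩ := hg
  rw [funext hh]
  fun_prop

protected theorem apply_zero (hg : HasCubicJet g a b c d) : g 0 = a := by
  obtain ⟨h, hc, hh⟩ := hg
  simp [hh]

/-- Composition with an inner function vanishing at the origin. -/
theorem comp {v : ℂ → ℂ} {p q s : ℂ} (hg : HasCubicJet g a b c d) (hv : HasCubicJet v 0 p q s) :
    HasCubicJet (fun y => g (v y)) a (b * p) (b * q + c * p ^ 2)
      (b * s + 2 * c * p * q + d * p ^ 3) := by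
  obtain ⟨h, hc, hh⟩ := hg
  have hvc := hv.continuousAt
  have hhv : ContinuousAt (fun y => h (v y)) 0 :=
    ContinuousAt.comp (by rwa [hv.apply_zero]) hvc
  have hrem : HasCubicJet (fun y => v y ^ 4 * h (v y)) 0 0 0 0 := by
    obtain ⟨k, hk, hkk⟩ := hv
    refine ⟨fun y => (p + q * y + s * y ^ 2 + y ^ 3 * k y) ^ 4 * h (v y),
      ContinuousAt.mul (by fun_prop) hhv, fun y => ?_⟩
    have : v y = y * (p + q * y + s * y ^ 2 + y ^ 3 * k y) := by rw [hkk]; ring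
    simp only [show v y ^ 4 = (y * (p + q * y + s * y ^ 2 + y ^ 3 * k y)) ^ 4 by rw [← this]]
    ring
  have key := (((const a).add ((const b).mul hv)).add ((const c).mul (hv.mul hv))).add
    ((const d).mul (hv.mul (hv.mul hv))) |>.add hrem
  rw [show (fun y => g (v y)) = fun y => a + b * v y + c * (v y * v y)
    + d * (v y * (v y * v y)) + v y ^ 4 * h (v y) from funext fun y => by rw [hh]; ring]
  exact key.congr_coeff (by ring) (by ring) (by ring) (by ring)

theorem eq_zero_of_eventually_add_mul_eq_zero {k : ℂ} {K : ℂ → ℂ} (hK : ContinuousAt K 0)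
    (h : ∀ᶠ y in 𝓝[≠] (0 : ℂ), k + y * K y = 0) :
    k = 0 ∧ ∀ᶠ y in 𝓝[≠] (0 : ℂ), K y = 0 := by
  have hk : k = 0 := by
    have ht : Tendsto (fun y => k + y * K y) (𝓝[≠] 0) (𝓝 (k + 0 * K 0)) :=
      (ContinuousAt.tendsto (f := fun y => k + y * K y) (by fun_prop)).mono_left nhdsWithin_le_nhds
    simpa using tendsto_nhds_unique ht (tendsto_const_nhds.congr' (h.mono fun y hy => hy.symm))
  refine ⟨hk, ?_⟩
  filter_upwards [h, self_mem_nhdsWithin] with y hy hy0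
  simpa [hk, show y ≠ 0 from hy0] using hy

/-- Functions agreeing on a punctured neighbourhood have the same cubic jet. -/
theorem unique (hg : HasCubicJet g a b c d) (hg' : HasCubicJet g' a' b' c' d')
    (h : ∀ᶠ y in 𝓝[≠] (0 : ℂ), g y = g' y) : a = a' ∧ b = b' ∧ c = c' ∧ d = d' := by
  obtain ⟨k, hk, hkk⟩ := hg.sub hg'
  have h0 : ∀ᶠ y in 𝓝[≠] (0 : ℂ), (a - a') + y * ((b - b') + y * ((c - c') + y * ((d - d')
      + y * k y))) = 0 := by
    filter_upwards [h] with y hy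
    linear_combination hy - hkk y
  obtain ⟨ha, h1⟩ := eq_zero_of_eventually_add_mul_eq_zero (by fun_prop) h0
  obtain ⟨hb, h2⟩ := eq_zero_of_eventually_add_mul_eq_zero (by fun_prop) h1
  obtain ⟨hc, h3⟩ := eq_zero_of_eventually_add_mul_eq_zero (by fun_prop) h2
  obtain ⟨hd, -⟩ := eq_zero_of_eventually_add_mul_eq_zero (by fun_prop) h3
  exact ⟨sub_eq_zero.1 ha, sub_eq_zero.1 hb, sub_eq_zero.1 hc, sub_eq_zero.1 hd⟩

end HasCubicJet


/-- Concluding remark of the proof of Lemma 6: the exponential `f` of the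
Buchstaber formal group `F(u,v) = (u²A(v) - v²A(u))/(uB(v) - vB(u))`
satisfies equation (feq):
`f f''' - 3 f' f'' = C₁ (f')² + C₂ f f' + C₃ f²` with
`C₁ = -3A₁`, `C₂ = A₁² - 4B₂`, `C₃ = 6(A₃ - B₃)`. -/
theorem elliptic_level4_Buchstaber_feq
    (A B f : ℂ → ℂ) (ρ r : ℝ) (hρ : 0 < ρ) (hr : 0 < r) (A₁ B₂ A₃ B₃ : ℂ)
    (hA : AnalyticOnNhd ℂ A (Metric.ball 0 ρ))
    (hB : AnalyticOnNhd ℂ B (Metric.ball 0 ρ))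
    (hA0 : A 0 = 1) (hB0 : B 0 = 1)
    (hB'0 : deriv B 0 = 0) (hA''0 : iteratedDeriv 2 A 0 = 0)
    (hA₁ : A₁ = deriv A 0) (hB₂ : B₂ = iteratedDeriv 2 B 0 / 2)
    (hA₃ : A₃ = iteratedDeriv 3 A 0 / 6) (hB₃ : B₃ = iteratedDeriv 3 B 0 / 6)
    (hf : AnalyticOnNhd ℂ f (Metric.ball 0 r))
    (hf0 : f 0 = 0) (hf'0 : deriv f 0 = 1)
    (hmaps : Set.MapsTo f (Metric.ball 0 (r / 2)) (Metric.ball 0 ρ))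
    (hadd : ∀ x ∈ Metric.ball (0 : ℂ) (r / 2), ∀ y ∈ Metric.ball (0 : ℂ) (r / 2),
      x + y ∈ Metric.ball (0 : ℂ) r →
      f (x + y) * (f x * B (f y) - f y * B (f x))
        = (f x) ^ 2 * A (f y) - (f y) ^ 2 * A (f x)) :
    ∃ ε > 0, ∀ x ∈ Metric.ball (0 : ℂ) ε,
      f x * deriv (deriv (deriv f)) x - 3 * deriv f x * deriv (deriv f) x
        = (-3 * A₁) * (deriv f x) ^ 2 + (A₁ ^ 2 - 4 * B₂) * f x * deriv f x
          + 6 * (A₃ - B₃) * (f x) ^ 2 := by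
  have h0r : (0 : ℂ) ∈ Metric.ball (0 : ℂ) r := Metric.mem_ball_self hr
  have h0ρ : (0 : ℂ) ∈ Metric.ball (0 : ℂ) ρ := Metric.mem_ball_self hρ
  have jA : HasCubicJet A 1 A₁ 0 A₃ := by
    simpa [hA0, ← hA₁, hA''0, ← hA₃] using (hA 0 h0ρ).hasCubicJet
  have jB : HasCubicJet B 1 0 B₂ B₃ := by
    simpa [hB0, hB'0, ← hB₂, ← hB₃] using (hB 0 h0ρ).hasCubicJet
  obtain ⟨a, ha⟩ : ∃ a, a = iteratedDeriv 2 f 0 := ⟨_, rfl⟩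
  obtain ⟨b, hb⟩ : ∃ b, b = iteratedDeriv 3 f 0 := ⟨_, rfl⟩
  have jf : HasCubicJet f 0 1 (a / 2) (b / 6) := by
    simpa [hf0, hf'0, ← ha, ← hb] using (hf 0 h0r).hasCubicJet
  -- The coefficients of `y`, `y ^ 2` and `y ^ 3` of the addition law.
  have expand : ∀ x ∈ Metric.ball (0 : ℂ) (r / 2),
      f x * deriv f x = f x * (B (f x) + A₁ * f x) ∧
      f x * (f x * B₂ - B (f x) * (a / 2)) - deriv f x * B (f x)
        + deriv (deriv f) x / 2 * f x = f x ^ 2 * (A₁ * (a / 2)) - A (f x) ∧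
      f x * (f x * (B₂ * a + B₃) - B (f x) * (b / 6))
        + deriv f x * (f x * B₂ - B (f x) * (a / 2)) - deriv (deriv f) x / 2 * B (f x)
        + deriv (deriv (deriv f)) x / 6 * f x
        = f x ^ 2 * (A₁ * (b / 6) + A₃) - A (f x) * a := by
    intro x hx
    have hxr : x ∈ Metric.ball (0 : ℂ) r := Metric.ball_subset_ball (by linarith) hx
    have jx := (hf x hxr).hasCubicJet
    simp only [iteratedDeriv_succ, iteratedDeriv_zero] at jx
    have key := (jx.mul (((HasCubicJet.const (f x)).mul (jB.comp jf)).sub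
      (jf.mul (HasCubicJet.const (B (f x)))))).unique
      (((HasCubicJet.const (f x ^ 2)).mul (jA.comp jf)).sub
      ((jf.mul jf).mul (HasCubicJet.const (A (f x))))) ?_
    · obtain ⟨-, h1, h2, h3⟩ := key
      exact ⟨by linear_combination h1, by linear_combination h2, by linear_combination h3⟩
    · filter_upwards [nhdsWithin_le_nhds (Metric.ball_mem_nhds (0 : ℂ) (half_pos hr))] with y hy
      have hxy : x + y ∈ Metric.ball (0 : ℂ) r := by
        rw [mem_ball_zero_iff] at hx hy ⊢
        linarith [norm_add_le x y]
      linear_combination hadd x hx y hy hxy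
  have hne : ∀ᶠ x in 𝓝[≠] (0 : ℂ), f x ≠ 0 :=
    (hf 0 h0r).differentiableAt.hasDerivAt.eventually_ne (by simp [hf'0])
  have hderiv : ∀ᶠ x in 𝓝[≠] (0 : ℂ), deriv f x = B (f x) + A₁ * f x := by
    filter_upwards [hne, nhdsWithin_le_nhds (Metric.ball_mem_nhds (0 : ℂ) (half_pos hr))]
      with x hx hxr
    exact mul_left_cancel₀ hx (expand x hxr).1
  have jf' : HasCubicJet (deriv f) 1 a (b / 2) (iteratedDeriv 3 (deriv f) 0 / 6) := by
    have := (hf 0 h0r).deriv.hasCubicJet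
    simp only [zero_add, hf'0, ← iteratedDeriv_succ' (n := 2), ← hb] at this
    rwa [show deriv (deriv f) 0 = a by rw [ha, iteratedDeriv_succ, iteratedDeriv_one]] at this
  obtain ⟨-, ha', hb', -⟩ :=
    jf'.unique ((jB.comp jf).add ((HasCubicJet.const A₁).mul jf)) hderiv
  have haA : a = A₁ := by linear_combination ha'
  have hbA : b = 2 * B₂ + A₁ ^ 2 := by linear_combination 2 * hb' + A₁ * haA
  have hderiv' : ∀ᶠ x in 𝓝 (0 : ℂ), deriv f x = B (f x) + A₁ * f x := by
    filter_upwards [eventually_nhdsWithin_iff.1 hderiv] with x hx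
    rcases eq_or_ne x 0 with rfl | h
    · simp [hf0, hf'0, hB0]
    · exact hx h
  refine Metric.eventually_nhds_iff_ball.1 ?_
  filter_upwards [hderiv', Metric.ball_mem_nhds (0 : ℂ) (half_pos hr)] with x hx hxr
  obtain ⟨-, h2, h3⟩ := expand x hxr
  have hβ : B (f x) = deriv f x - A₁ * f x := by linear_combination -hx
  rw [hβ, haA] at h2 h3
  rw [hbA] at h3
  linear_combination 6 * h3 - 6 * A₁ * h2
end

section
/- Let α, β, γ, λ ∈ ℂ and let f : ℂ → ℂ be analytic on a ball B(0,r), r > 0, with f(x) ≠ 0 for all x ∈ B(0,r) with x ≠ 0, whose Taylor coefficients aₖ at 0 satisfy a₀ = 0, a₁ = 1, a₂ = α, a₃ = (α² + β)/2, a₄ = (α³ + 3αβ − γ)/6, a₅ = (5α⁴ + 30α²β + 45β² − 20αγ − 3λ)/120, and which satisfies on B(0,r) the differential equation f·f''' − 3·f'·f'' = C₁·(f')² + C₂·f·f' + C₃·f² with C₁ = −6α, C₂ = 6α² − 6β, C₃ = 2γ + 6αβ − 2α³. Suppose that for all pairwise distinct x₁, x₂, x₃ ∈ B(0,r/2): 1/(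 f(x₂ − x₁)·f(x₃ − x₁) ) + 1/( f(x₁ − x₂)·f(x₃ − x₂) ) + 1/( f(x₁ − x₃)·f(x₂ − x₃) ) = 0. Then β = 3α² and λ = 12α(9α³ + γ). -/
theorem iteratedDeriv_comp_const_mul_apply {𝕜 F : Type*} [NontriviallyNormedField 𝕜]
    [NormedAddCommGroup F] [NormedSpace 𝕜 F] (n : ℕ) (f : 𝕜 → F) (c x : 𝕜) :
    iteratedDeriv n (fun z ↦ f (c * z)) x = c ^ n • iteratedDeriv n f (c * x) := by
  induction n generalizing x with
  | zero => simp
  | succ n ih =>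
    rw [iteratedDeriv_succ, funext ih, deriv_fun_const_smul_field,
      deriv_comp_mul_left c (iteratedDeriv n f), ← iteratedDeriv_succ, smul_smul, pow_succ]

/-- Lemma 7 (talem) of the paper: if a function of the form `f_Kr` with
parameters `α, β, γ, λ` (characterized by its Taylor expansion up to order 5
and the differential equation (feq)) satisfies the 3rd special Hirzebruch
functional equation, then `β = 3α²` and `λ = 12α(9α³ + γ)`. -/
theorem elliptic_level3_talem
    (α β γ lam : ℂ) (f : ℂ → ℂ) (r : ℝ) (hr : 0 < r)
    (hf : AnalyticOnNhd ℂ f (Metric.ball 0 r))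
    (hne : ∀ x ∈ Metric.ball (0 : ℂ) r, x ≠ 0 → f x ≠ 0)
    (ha0 : f 0 = 0) (ha1 : deriv f 0 = 1)
    (ha2 : iteratedDeriv 2 f 0 = 2 * α)
    (ha3 : iteratedDeriv 3 f 0 = 6 * ((α ^ 2 + β) / 2))
    (ha4 : iteratedDeriv 4 f 0 = 24 * ((α ^ 3 + 3 * α * β - γ) / 6))
    (ha5 : iteratedDeriv 5 f 0
      = 120 * ((5 * α ^ 4 + 30 * α ^ 2 * β + 45 * β ^ 2 - 20 * α * γ - 3 * lam) / 120))
    (hfeq : ∀ x ∈ Metric.ball (0 : ℂ) r,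
      f x * deriv (deriv (deriv f)) x - 3 * deriv f x * deriv (deriv f) x
        = (-6 * α) * (deriv f x) ^ 2 + (6 * α ^ 2 - 6 * β) * f x * deriv f x
          + (2 * γ + 6 * α * β - 2 * α ^ 3) * (f x) ^ 2)
    (hHir : ∀ x₁ ∈ Metric.ball (0 : ℂ) (r / 2), ∀ x₂ ∈ Metric.ball (0 : ℂ) (r / 2),
      ∀ x₃ ∈ Metric.ball (0 : ℂ) (r / 2),
      x₁ ≠ x₂ → x₁ ≠ x₃ → x₂ ≠ x₃ →
      1 / (f (x₂ - x₁) * f (x₃ - x₁)) + 1 / (f (x₁ - x₂) * f (x₃ - x₂))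
        + 1 / (f (x₁ - x₃) * f (x₂ - x₃)) = 0) :
    β = 3 * α ^ 2 ∧ lam = 12 * α * (9 * α ^ 3 + γ) := by
  have key : (fun x ↦ f (1 * x) * f (2 * x) + f (-1 * x) * f (-2 * x) + f (2 * x) * f (-2 * x))
      =ᶠ[nhds 0] fun _ ↦ 0 := by
    filter_upwards [Metric.ball_mem_nhds (0 : ℂ) (half_pos hr)] with x hx
    rcases eq_or_ne x 0 with rfl | hx0
    · simp [ha0]
    have hx' : ‖x‖ < r / 2 := by simpa using hx
    have hr1 : ‖x‖ < r := by linarith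
    have hr2 : 2 * ‖x‖ < r := by linarith
    have h1 : f x ≠ 0 := hne x (by simpa using hr1) hx0
    have h2 : f (-x) ≠ 0 := hne (-x) (by simpa using hr1) (neg_ne_zero.mpr hx0)
    have h3 : f (2 * x) ≠ 0 := hne (2 * x) (by simpa using hr2) (by simpa using hx0)
    have h4 : f (-(2 * x)) ≠ 0 := hne (-(2 * x)) (by simpa using hr2) (by simpa using hx0)
    have h := hHir (-x) (by simpa using hx') 0 (by simpa using half_pos hr) x hx
      (by simpa using hx0) (fun h ↦ hx0 (self_eq_neg.mp h.symm)) hx0.symm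
    rw [show (0 : ℂ) - -x = x by ring, show x - -x = 2 * x by ring, show -x - 0 = -x by ring,
      sub_zero, show -x - x = -(2 * x) by ring, zero_sub] at h
    field_simp at h
    simp only [one_mul, neg_mul]
    linear_combination h
  have hf0 : AnalyticAt ℂ f 0 := hf 0 (Metric.mem_ball_self hr)
  have hc (n : ℕ) (c : ℂ) : ContDiffAt ℂ n (fun x ↦ f (c * x)) 0 := by
    refine ContDiffAt.comp (g := f) (0 : ℂ) ?_ (by fun_prop)
    simpa using hf0.contDiffAt
  have expand (n : ℕ) (c d : ℂ) : iteratedDeriv n (fun x ↦ f (c * x) * f (d * x)) 0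
      = ∑ i ∈ Finset.range (n + 1),
        n.choose i * (c ^ i * iteratedDeriv i f 0) * (d ^ (n - i) * iteratedDeriv (n - i) f 0) := by
    rw [iteratedDeriv_fun_mul (hc n c) (hc n d)]
    simp [iteratedDeriv_comp_const_mul_apply]
  have coeff (n : ℕ) := key.iteratedDeriv_eq n
  simp_rw [fun n ↦ iteratedDeriv_fun_add (((hc n 1).mul (hc n 2)).add ((hc n (-1)).mul (hc n (-2))))
    ((hc n 2).mul (hc n (-2))), fun n ↦ iteratedDeriv_fun_add ((hc n 1).mul (hc n 2))
    ((hc n (-1)).mul (hc n (-2))), expand] at coeff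
  have e4 := coeff 4
  have e6 := coeff 6
  simp [Finset.sum_range_succ, Nat.choose, ha0, ha1, ha2, ha3, ha4, ha5] at e4 e6
  have hβ : β = 3 * α ^ 2 := by
    linear_combination (-1 / 144) * e4
  refine ⟨hβ, ?_⟩
  subst hβ
  linear_combination (1 / 1080) * e6
end

section
/- Let α, β, γ, λ ∈ ℂ with α ≠ 0, and let f : ℂ → ℂ be analytic on a ball B(0,r), r > 0, with f(x) ≠ 0 for all x ∈ B(0,r) with x ≠ 0, whose Taylor coefficients aₖ at 0 satisfy a₀ = 0, a₁ = 1, a₂ = α, a₃ = (α² + β)/2, a₄ = (α³ + 3αβ − γ)/6, a₅ = (5α⁴ + 30α²β + 45β² − 20αγ − 3λ)/120, and which satisfies on B(0,r) the differential equation f·f''' − 3·f'·f'' = C₁·(f')² + C₂·f·f' + C₃·f² with C₁ = −6α, C₂ = 6α² − 6β, C₃ = 2γ + 6αβ − 2α³. Suppose that for all pairwise distinct x₁, x₂, x₃, x₄ ∈ B(0,r/2): Σ_{i=1}^{4} Π_{j ≠ i} 1/f(x_j − x_i) = 0. Then γ = 4α(4α² − 3β) and λ = 4(32α⁴ − 24α²β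 + 3β²). -/
open Filter Topology

lemma iteratedDeriv_comp_const_mul_field {𝕜 : Type*} [NontriviallyNormedField 𝕜]
    (f : 𝕜 → 𝕜) (c : 𝕜) (n : ℕ) (x : 𝕜) :
    iteratedDeriv n (fun t => f (c * t)) x = c ^ n * iteratedDeriv n f (c * x) := by
  induction n generalizing x with
  | zero => simp
  | succ n ih =>
    rw [iteratedDeriv_succ, funext ih, deriv_const_mul_field,
      deriv_comp_mul_left c (iteratedDeriv n f) x, ← iteratedDeriv_succ, smul_eq_mul]
    ring

lemma iteratedDeriv_deriv {𝕜 : Type*} [NontriviallyNormedField 𝕜] (f : 𝕜 → 𝕜) (n : ℕ) (x : 𝕜) :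
    iteratedDeriv n (deriv f) x = iteratedDeriv (n + 1) f x := by
  rw [iteratedDeriv_succ']

/-- An analytic function with a simple zero at the origin, of unit slope, divides the identity. -/
lemma AnalyticAt.exists_mul_eq_id {f : ℂ → ℂ} (hf : AnalyticAt ℂ f 0) (h0 : f 0 = 0)
    (h1 : deriv f 0 = 1) :
    ∃ h : ℂ → ℂ, AnalyticAt ℂ h 0 ∧ h 0 = 1 ∧ (∀ᶠ x in 𝓝 0, f x * h x = x) ∧
      ∀ x, x ≠ 0 → h x = x / f x := by
  obtain ⟨p, hp⟩ := hf
  have hg : AnalyticAt ℂ (dslope f 0) 0 := ⟨_, hp.has_fpower_series_dslope_fslope⟩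
  have hg0 : dslope f 0 0 = 1 := by rw [dslope_same, h1]
  have hx (x : ℂ) (hx : x ≠ 0) : dslope f 0 x = f x / x := by
    rw [dslope_of_ne _ hx, slope_def_field, h0, sub_zero, sub_zero]
  refine ⟨fun x => (dslope f 0 x)⁻¹, hg.inv (by rw [hg0]; exact one_ne_zero), by simp [h1], ?_,
    fun x h => by simp [hx x h]⟩
  filter_upwards [hg.continuousAt.eventually_ne (hg0.trans_ne one_ne_zero)] with x hne
  rcases eq_or_ne x 0 with rfl | h
  · simp [h0]
  · rw [hx x h] at hne ⊢
    have : f x ≠ 0 := fun h' => hne (by simp [h'])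
    field_simp

/-- The Leibniz rule at the origin for a factorization of the identity. -/
lemma iteratedDeriv_of_mul_eq_id {f h : ℂ → ℂ} (hf : AnalyticAt ℂ f 0) (hh : AnalyticAt ℂ h 0)
    (hfh : ∀ᶠ x in 𝓝 0, f x * h x = x) (n : ℕ) :
    ∑ i ∈ Finset.range (n + 1), n.choose i * iteratedDeriv i f 0 * iteratedDeriv (n - i) h 0
      = if n = 1 then 1 else 0 := by
  rw [← iteratedDeriv_mul hf.contDiffAt hh.contDiffAt,
    EventuallyEq.iteratedDeriv_eq n (g := id) (by simpa [EventuallyEq] using hfh), iteratedDeriv_id]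
  split_ifs <;> simp_all

/-- Lemma 10 (talem2) of the paper: if a function of the form `f_Kr` with
parameters `α, β, γ, λ`, `α ≠ 0` (characterized by its Taylor expansion up to
order 5 and the differential equation (feq)) satisfies the 4th special
Hirzebruch functional equation, then `γ = 4α(4α² - 3β)` and
`λ = 4(32α⁴ - 24α²β + 3β²)`. -/
theorem elliptic_level4_talem2
    (α β γ lam : ℂ) (hα : α ≠ 0) (f : ℂ → ℂ) (r : ℝ) (hr : 0 < r)
    (hf : AnalyticOnNhd ℂ f (Metric.ball 0 r))
    (hne : ∀ x ∈ Metric.ball (0 : ℂ) r, x ≠ 0 → f x ≠ 0)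
    (ha0 : f 0 = 0) (ha1 : deriv f 0 = 1)
    (ha2 : iteratedDeriv 2 f 0 = 2 * α)
    (ha3 : iteratedDeriv 3 f 0 = 6 * ((α ^ 2 + β) / 2))
    (ha4 : iteratedDeriv 4 f 0 = 24 * ((α ^ 3 + 3 * α * β - γ) / 6))
    (ha5 : iteratedDeriv 5 f 0
      = 120 * ((5 * α ^ 4 + 30 * α ^ 2 * β + 45 * β ^ 2 - 20 * α * γ - 3 * lam) / 120))
    (hfeq : ∀ x ∈ Metric.ball (0 : ℂ) r,
      f x * deriv (deriv (deriv f)) x - 3 * deriv f x * deriv (deriv f) x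
        = (-6 * α) * (deriv f x) ^ 2 + (6 * α ^ 2 - 6 * β) * f x * deriv f x
          + (2 * γ + 6 * α * β - 2 * α ^ 3) * (f x) ^ 2)
    (hHir : ∀ x₁ ∈ Metric.ball (0 : ℂ) (r / 2), ∀ x₂ ∈ Metric.ball (0 : ℂ) (r / 2),
      ∀ x₃ ∈ Metric.ball (0 : ℂ) (r / 2), ∀ x₄ ∈ Metric.ball (0 : ℂ) (r / 2),
      x₁ ≠ x₂ → x₁ ≠ x₃ → x₁ ≠ x₄ → x₂ ≠ x₃ → x₂ ≠ x₄ → x₃ ≠ x₄ →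
      1 / (f (x₂ - x₁) * f (x₃ - x₁) * f (x₄ - x₁))
        + 1 / (f (x₁ - x₂) * f (x₃ - x₂) * f (x₄ - x₂))
        + 1 / (f (x₁ - x₃) * f (x₂ - x₃) * f (x₄ - x₃))
        + 1 / (f (x₁ - x₄) * f (x₂ - x₄) * f (x₃ - x₄)) = 0) :
    γ = 4 * α * (4 * α ^ 2 - 3 * β) ∧
      lam = 4 * (32 * α ^ 4 - 24 * α ^ 2 * β + 3 * β ^ 2) := by
  have h0r : (0 : ℂ) ∈ Metric.ball 0 r := Metric.mem_ball_self hr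
  have hf0 : AnalyticAt ℂ f 0 := hf 0 h0r
  obtain ⟨h, hh, hh0, hfh, hhx⟩ := hf0.exists_mul_eq_id ha0 ha1
  have e0 : iteratedDeriv 0 f 0 = 0 := by simpa using ha0
  have e1 : iteratedDeriv 1 f 0 = 1 := by simpa using ha1
  -- the sixth derivative of `f`, from the differential equation
  have e6 : iteratedDeriv 6 f 0 = 9 * (iteratedDeriv 2 f 0 * iteratedDeriv 5 f 0)
      + 25 * (iteratedDeriv 3 f 0 * iteratedDeriv 4 f 0)
      - 6 * α * (2 * iteratedDeriv 5 f 0 + 8 * (iteratedDeriv 2 f 0 * iteratedDeriv 4 f 0)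
        + 6 * iteratedDeriv 3 f 0 ^ 2)
      + (6 * α ^ 2 - 6 * β) * (5 * iteratedDeriv 4 f 0
        + 10 * (iteratedDeriv 2 f 0 * iteratedDeriv 3 f 0))
      + (2 * γ + 6 * α * β - 2 * α ^ 3) * (8 * iteratedDeriv 3 f 0
        + 6 * iteratedDeriv 2 f 0 ^ 2) := by
    have hd0 (n : ℕ) : ContDiffAt ℂ n f 0 := hf0.contDiffAt
    have hd1 (n : ℕ) : ContDiffAt ℂ n (deriv f) 0 := hf0.deriv.contDiffAt
    have hd2 (n : ℕ) : ContDiffAt ℂ n (deriv (deriv f)) 0 := hf0.deriv.deriv.contDiffAt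
    have hd3 (n : ℕ) : ContDiffAt ℂ n (deriv (deriv (deriv f))) 0 :=
      hf0.deriv.deriv.deriv.contDiffAt
    have key : (fun x => f x * deriv (deriv (deriv f)) x - 3 * (deriv f x * deriv (deriv f) x))
        =ᶠ[𝓝 0] fun x => (-6 * α) * (deriv f x * deriv f x)
          + (6 * α ^ 2 - 6 * β) * (f x * deriv f x)
          + (2 * γ + 6 * α * β - 2 * α ^ 3) * (f x * f x) := by
      filter_upwards [Metric.isOpen_ball.mem_nhds h0r] with x hx
      linear_combination hfeq x hx
    have := key.iteratedDeriv_eq 4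
    simp (discharger := fun_prop) only [iteratedDeriv_fun_add, iteratedDeriv_fun_sub,
      iteratedDeriv_const_mul_field, iteratedDeriv_fun_mul, iteratedDeriv_deriv] at this
    simp only [Finset.sum_range_succ, Finset.sum_range_zero, Nat.choose, Nat.reduceSub,
      Nat.reduceAdd, e0, e1] at this
    push_cast at this
    linear_combination this
  have hb := iteratedDeriv_of_mul_eq_id hf0 hh hfh
  have b0 : iteratedDeriv 0 h 0 = 1 := by simpa using hh0
  -- the derivatives of `h`
  have b1 : iteratedDeriv 1 h 0 = -α := by
    have hb2 := hb 2
    simp [Finset.sum_range_succ, Nat.choose, e0, e1, ha2, b0, -iteratedDeriv_zero,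
      -iteratedDeriv_one] at hb2
    linear_combination (1 / 2) * hb2
  have b2 : iteratedDeriv 2 h 0 = α ^ 2 - β := by
    have hb3 := hb 3
    simp [Finset.sum_range_succ, Nat.choose, e0, e1, ha2, ha3, b0, b1,
      -iteratedDeriv_zero, -iteratedDeriv_one] at hb3
    linear_combination (1 / 3) * hb3
  have b3 : iteratedDeriv 3 h 0 = -α ^ 3 + 3 * α * β + γ := by
    have hb4 := hb 4
    simp [Finset.sum_range_succ, Nat.choose, e0, e1, ha2, ha3, ha4, b0, b1, b2,
      -iteratedDeriv_zero, -iteratedDeriv_one] at hb4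
    linear_combination (1 / 4) * hb4
  have b4 : iteratedDeriv 4 h 0 = α ^ 4 - 6 * α ^ 2 * β - 4 * α * γ - 3 * β ^ 2 + 3/5 * lam := by
    have hb5 := hb 5
    simp [Finset.sum_range_succ, Nat.choose, e0, e1, ha2, ha3, ha4, ha5, b0, b1, b2, b3,
      -iteratedDeriv_zero, -iteratedDeriv_one] at hb5
    linear_combination (1 / 5) * hb5
  have b5 : iteratedDeriv 5 h 0 = -α ^ 5 + 10 * α ^ 3 * β + 10 * α ^ 2 * γ
      + 15 * α * β ^ 2 - 3 * α * lam + 2 * β * γ := by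
    have hb6 := hb 6
    simp [Finset.sum_range_succ, Nat.choose, e0, e1, ha2, ha3, ha4, ha5, e6, b0, b1, b2, b3, b4,
      -iteratedDeriv_zero, -iteratedDeriv_one] at hb6
    linear_combination (1 / 6) * hb6
  obtain ⟨u, hu⟩ : ∃ u : ℂ → ℂ → ℂ, ∀ c t, u c t = h (c * t) := ⟨fun c t => h (c * t), by simp⟩
  have hG : (fun t : ℂ => 1 / 6 * (u 1 t * (u 2 t * u 3 t))
      + -1 / 2 * (u (-1) t * (u 1 t * u 2 t))
      + 1 / 2 * (u (-2) t * (u (-1) t * u 1 t))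
      + -1 / 6 * (u (-3) t * (u (-2) t * u (-1) t))) =ᶠ[𝓝 0] fun _ => 0 := by
    simp only [hu]
    filter_upwards [Metric.ball_mem_nhds (0 : ℂ) (by positivity : 0 < r / 6)] with t ht
    rcases eq_or_ne t 0 with rfl | ht0
    · norm_num [hh0]
    have hm (c : ℂ) (hc : ‖c‖ ≤ 3) : c * t ∈ Metric.ball (0 : ℂ) (r / 2) := by
      rw [mem_ball_zero_iff] at ht ⊢
      rw [norm_mul]
      nlinarith [norm_nonneg t]
    have hd (c d : ℂ) (hcd : c ≠ d) : c * t ≠ d * t := fun h => hcd (mul_right_cancel₀ ht0 h)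
    have H := hHir (0 * t) (hm 0 (by simp)) (1 * t) (hm 1 (by simp)) (2 * t) (hm 2 (by norm_num))
      (3 * t) (hm 3 (by simp)) (hd _ _ (by norm_num)) (hd _ _ (by norm_num))
      (hd _ _ (by norm_num)) (hd _ _ (by norm_num)) (hd _ _ (by norm_num))
      (hd _ _ (by norm_num))
    simp only [← sub_mul] at H
    norm_num only at H
    have hx (c : ℂ) (hc : c ≠ 0) := hhx (c * t) (mul_ne_zero hc ht0)
    rw [hx 1 (by norm_num), hx 2 (by norm_num), hx 3 (by norm_num), hx (-1) (by norm_num),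
      hx (-2) (by norm_num), hx (-3) (by norm_num)]
    linear_combination t ^ 3 * H
  have hua (c : ℂ) (n : ℕ) : ContDiffAt ℂ n (u c) 0 := by
    have : AnalyticAt ℂ h (c * 0) := by simpa using hh
    have hcomp := this.fun_comp (f := fun t => c * t) (by fun_prop)
    simp only [← hu] at hcomp
    exact hcomp.contDiffAt
  have hu' (c : ℂ) (n : ℕ) : iteratedDeriv n (u c) 0 = c ^ n * iteratedDeriv n h 0 := by
    simpa [← hu] using iteratedDeriv_comp_const_mul_field h c n 0
  have hG3 := hG.iteratedDeriv_eq 3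
  have hG5 := hG.iteratedDeriv_eq 5
  simp (discharger := fun_prop) only [iteratedDeriv_fun_add, iteratedDeriv_const,
      iteratedDeriv_const_mul_field, iteratedDeriv_fun_mul] at hG3 hG5
  simp [Finset.sum_range_succ, Nat.choose, hu', b0, b1, b2, b3, b4, b5, -iteratedDeriv_zero,
    -iteratedDeriv_one] at hG3 hG5
  have hγ : γ = 4 * α * (4 * α ^ 2 - 3 * β) := by linear_combination (1 / 4) * hG3
  refine ⟨hγ, mul_left_cancel₀ hα ?_⟩
  rw [hγ] at hG5
  linear_combination (-1 / 480) * hG5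
end

section
/- Let a₁, a₂ ∈ ℂ and set g₂ = 4(a₁ + 3a₂)(3a₁ + a₂), g₃ = −8(a₁ + a₂)(a₁ − a₂)², g̃₂ = g₂ − 20a₁a₂, g̃₃ = g₃ − 28a₁a₂(a₁ + a₂). Let U ⊆ ℂ be open and let q : ℂ → ℂ be differentiable on U with q(x) ≠ a₁ + a₂ for all x ∈ U, satisfying q'(x)² = 4q(x)³ − g̃₂·q(x) − g̃₃ on U. Define p : U → ℂ by p(x) = (q(x) − a₁)(q(x) − a₂)/(q(x) − a₁ − a₂). Then p is differentiable on U and p'(x)² = 4p(x)³ − g₂·p(x) − g₃ for all x ∈ U. -/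
/-- The 2-isogeny construction of Section 4 of the paper (relations (iso)):
if `q` satisfies the Weierstrass equation with invariants
`g̃₂ = g₂ - 20a₁a₂`, `g̃₃ = g₃ - 28a₁a₂(a₁+a₂)`, then
`p = (q - a₁)(q - a₂)/(q - a₁ - a₂)` satisfies the Weierstrass equation with
invariants `g₂ = 4(a₁+3a₂)(3a₁+a₂)`, `g₃ = -8(a₁+a₂)(a₁-a₂)²`. -/
theorem elliptic_level4_isogeny
    (a₁ a₂ : ℂ) (U : Set ℂ) (hU : IsOpen U) (q : ℂ → ℂ)
    (hq : DifferentiableOn ℂ q U)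
    (hqne : ∀ x ∈ U, q x ≠ a₁ + a₂)
    (hweq : ∀ x ∈ U, (deriv q x) ^ 2
      = 4 * q x ^ 3 - (4 * (a₁ + 3 * a₂) * (3 * a₁ + a₂) - 20 * a₁ * a₂) * q x
        - (-8 * (a₁ + a₂) * (a₁ - a₂) ^ 2 - 28 * a₁ * a₂ * (a₁ + a₂)))
    (p : ℂ → ℂ)
    (hp : ∀ x ∈ U, p x = (q x - a₁) * (q x - a₂) / (q x - a₁ - a₂)) :
    DifferentiableOn ℂ p U ∧
    ∀ x ∈ U, (deriv p x) ^ 2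
      = 4 * p x ^ 3 - 4 * (a₁ + 3 * a₂) * (3 * a₁ + a₂) * p x
        - (-8 * (a₁ + a₂) * (a₁ - a₂) ^ 2) := by
  have hne : ∀ x ∈ U, q x - a₁ - a₂ ≠ 0 := fun x hx h =>
    hqne x hx (by linear_combination h)
  have hderiv : ∀ x ∈ U, HasDerivAt p
      (((deriv q x * (q x - a₂) + (q x - a₁) * deriv q x) * (q x - a₁ - a₂)
        - (q x - a₁) * (q x - a₂) * deriv q x) / (q x - a₁ - a₂) ^ 2) x := by
    intro x hx
    have hqx : HasDerivAt q (deriv q x) x :=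
      (hq.differentiableAt (hU.mem_nhds hx)).hasDerivAt
    exact (((hqx.sub_const a₁).mul (hqx.sub_const a₂)).div
      ((hqx.sub_const a₁).sub_const a₂) (hne x hx)).congr_of_eventuallyEq
      (Filter.eventuallyEq_of_mem (hU.mem_nhds hx) hp)
  refine ⟨fun x hx => (hderiv x hx).differentiableAt.differentiableWithinAt, fun x hx => ?_⟩
  have hu := hne x hx
  have hw := hweq x hx
  rw [(hderiv x hx).deriv, hp x hx]
  obtain ⟨u, hqu⟩ : ∃ u, q x = u + a₁ + a₂ := ⟨q x - a₁ - a₂, by ring⟩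
  rw [hqu] at hu hw ⊢
  have hsub : u + a₁ + a₂ - a₁ - a₂ = u := by ring
  rw [hsub] at hu ⊢
  field_simp
  linear_combination (u ^ 2 - a₁ * a₂) ^ 2 * hw
end

section
/- Let α, β ∈ ℂ and set g₂ = −(13α⁴ − 6α²β − 3β²)/4, g₃ = (α² − β)(17α⁴ − 14α²β + β²)/8, c₁ = α² − β, c₂ = 51α⁴/8 − 21α²β/4 + 3β²/8, c₃ = −(α² − β)(47α⁴ − 34α²β − β²)/16, c₄ = 545α⁸/256 − 295α⁶β/64 + 435α⁴β²/128 − 55α²β³/64 + β⁴/256. Let U ⊆ ℂ be open and let p : ℂ → ℂ be three times differentiable on U with p'(x)² = 4p(x)³ − g₂·p(x) − g₃ and p''(x) = 6p(x)² − g₂/2 on U, and suppose p(x)⁴ + c₁p(x)³ + c₂p(x)² + c₃p(x) + c₄ ≠ 0 for all x ∈ U. Define f : U → ℂ by f(x) = [ α·(4p(x) + 3α² − β)(2p(x) − α² + β)(4p(x) − 7α² + 5β) − p'(x)·(4p(x) + 3α² − β)² ] / [ 32·( p(x)⁴ + c₁p(x)³ + c₂p(x)² + c₃p(x) + c₄ )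 ]. Then f is three times differentiable on U and f(x)·f'''(x) − 3·f'(x)·f''(x) = −6α·f'(x)² + 6(α² − β)·f(x)·f'(x) + 6α(5α² − 3β)·f(x)² for all x ∈ U. -/
open Filter Topology

/-- If `f * G = 1` and `3 G' G'' - G G''' = a G'² - b G G' + c G²`, then `f` satisfies
`f f''' - 3 f' f'' = a f'² + b f f' + c f²`. -/
lemma thirdOrder_of_mul_eq_one {f G G₁ G₂ G₃ : ℂ → ℂ} {V : Set ℂ} (hV : IsOpen V)
    (hfG : ∀ x ∈ V, f x * G x = 1) (hG : ∀ x ∈ V, HasDerivAt G (G₁ x) x)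
    (hG₁ : ∀ x ∈ V, HasDerivAt G₁ (G₂ x) x) (hG₂ : ∀ x ∈ V, HasDerivAt G₂ (G₃ x) x)
    {a b c : ℂ} {x : ℂ} (hx : x ∈ V)
    (hode : 3 * G₁ x * G₂ x - G x * G₃ x = a * G₁ x ^ 2 - b * G x * G₁ x + c * G x ^ 2) :
    f x * deriv (deriv (deriv f)) x - 3 * deriv f x * deriv (deriv f) x
      = a * deriv f x ^ 2 + b * f x * deriv f x + c * f x ^ 2 := by
  have hd₁ : ∀ z ∈ V, HasDerivAt f (-G₁ z * f z ^ 2) z := by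
    intro z hz
    have hG0 : G z ≠ 0 := right_ne_zero_of_mul_eq_one (hfG z hz)
    have hinv : ∀ t ∈ V, f t = (G t)⁻¹ := fun t ht => eq_inv_of_mul_eq_one_left (hfG t ht)
    have h := ((hG z hz).inv hG0).congr_of_eventuallyEq
      (f₁ := f) (by filter_upwards [hV.mem_nhds hz] with t ht using hinv t ht)
    refine h.congr_deriv ?_
    rw [hinv z hz]
    field_simp
  have hd₂ : ∀ z ∈ V, HasDerivAt (deriv f) (-G₂ z * f z ^ 2 + 2 * f z ^ 3 * G₁ z ^ 2) z := by
    intro z hz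
    have h := ((hG₁ z hz).neg.mul ((hd₁ z hz).pow 2)).congr_of_eventuallyEq (f₁ := deriv f)
      (by filter_upwards [hV.mem_nhds hz] with t ht using (hd₁ t ht).deriv)
    refine h.congr_deriv ?_
    simp only [Nat.cast_ofNat, Nat.reduceSub, pow_one, Pi.neg_apply, Pi.pow_apply]
    ring
  have hd₃ : HasDerivAt (deriv (deriv f))
      (-G₃ x * f x ^ 2 + 6 * f x ^ 3 * G₁ x * G₂ x - 6 * f x ^ 4 * G₁ x ^ 3) x := by
    have h := (((hG₂ x hx).neg.mul ((hd₁ x hx).pow 2)).add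
      ((((hd₁ x hx).pow 3).const_mul 2).mul ((hG₁ x hx).pow 2))).congr_of_eventuallyEq
      (f₁ := deriv (deriv f))
      (by filter_upwards [hV.mem_nhds hx] with t ht using (hd₂ t ht).deriv)
    refine h.congr_deriv ?_
    simp only [Nat.cast_ofNat, Nat.reduceSub, pow_one, Pi.neg_apply, Pi.pow_apply]
    ring
  rw [hd₃.deriv, (hd₂ x hx).deriv, (hd₁ x hx).deriv]
  have h1 := hfG x hx
  linear_combination f x ^ 4 * hode + (f x ^ 3 * G₃ x - b * f x ^ 3 * G₁ x
    + c * f x ^ 2 * (f x * G x + 1)) * h1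

/-- The function `-α + 2αδ / w - w' / (2 (w - δ))`, where
`w'² = (w - δ) (w² - 4 α² (w - δ))`, and its reciprocal. -/
lemma thirdOrder_of_quartic {f w y : ℂ → ℂ} {V : Set ℂ} (hV : IsOpen V) {α δ : ℂ}
    (hw : ∀ x ∈ V, HasDerivAt w (y x) x)
    (hy : ∀ x ∈ V, HasDerivAt y
      ((w x ^ 2 + 2 * w x * (w x - δ) - 8 * α ^ 2 * (w x - δ)) / 2) x)
    (hyw : ∀ x ∈ V, y x ^ 2 = (w x - δ) * (w x ^ 2 - 4 * α ^ 2 * (w x - δ)))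
    (hw0 : ∀ x ∈ V, w x ≠ 0) (hwδ : ∀ x ∈ V, w x - δ ≠ 0)
    (hf : ∀ x ∈ V, f x * (-α + 2 * α * δ / w x - y x / (2 * (w x - δ))) = 1)
    {x : ℂ} (hx : x ∈ V) :
    f x * deriv (deriv (deriv f)) x - 3 * deriv f x * deriv (deriv f) x
      = -6 * α * deriv f x ^ 2 + (2 * δ - 4 * α ^ 2) * f x * deriv f x
        + 6 * α * δ * f x ^ 2 := by
  refine thirdOrder_of_mul_eq_one hV hf
    (G₁ := fun z => -(2 * α * δ * y z) / w z ^ 2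
      - w z * (w z - 2 * δ) / (4 * (w z - δ)))
    (G₂ := fun z => α * δ * ((w z - 2 * δ) * (w z ^ 2 - 8 * α ^ 2 * (w z - δ))) / w z ^ 3
      - y z * (w z ^ 2 - 2 * δ * w z + 2 * δ ^ 2) / (4 * (w z - δ) ^ 2))
    (G₃ := fun z => α * δ * y z * (2 * δ * w z ^ 2 + 8 * α ^ 2 * w z ^ 2
        - 48 * α ^ 2 * δ * w z + 48 * α ^ 2 * δ ^ 2) / w z ^ 4
      - ((w z ^ 2 + 2 * w z * (w z - δ) - 8 * α ^ 2 * (w z - δ)) / 2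
          * (w z ^ 2 - 2 * δ * w z + 2 * δ ^ 2) / (4 * (w z - δ) ^ 2)
        - (w z ^ 2 - 4 * α ^ 2 * (w z - δ)) * δ ^ 2 / (2 * (w z - δ) ^ 2)))
    ?_ ?_ ?_ hx ?_
  · intro z hz
    have h0 := hw0 z hz
    have h1 := hwδ z hz
    have hW := (hw z hz).sub_const δ
    have h := (((hasDerivAt_const z (2 * α * δ)).div (hw z hz) h0).const_add (-α)).sub
      ((hy z hz).div (hW.const_mul 2) (mul_ne_zero two_ne_zero h1))
    refine h.congr_deriv ?_
    field_simp
    linear_combination (8 * w z ^ 2) * hyw z hz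
  · intro z hz
    have h0 := hw0 z hz
    have h1 := hwδ z hz
    have hW := (hw z hz).sub_const δ
    have h := (((hy z hz).const_mul (2 * α * δ)).neg.div ((hw z hz).pow 2)
      (pow_ne_zero 2 h0)).sub (((hw z hz).mul ((hw z hz).sub_const (2 * δ))).div
      (hW.const_mul 4) (mul_ne_zero (by norm_num) h1))
    refine h.congr_deriv ?_
    simp
    field_simp
    linear_combination (16 * α * δ * (w z - δ) ^ 2) * hyw z hz
  · intro z hz
    have h0 := hw0 z hz
    have h1 := hwδ z hz
    have hW := (hw z hz).sub_const δ
    have h := (((((hw z hz).sub_const (2 * δ)).mul (((hw z hz).pow 2).sub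
        (hW.const_mul (8 * α ^ 2)))).const_mul (α * δ)).div ((hw z hz).pow 3)
        (pow_ne_zero 3 h0)).sub
      (((hy z hz).mul ((((hw z hz).pow 2).sub ((hw z hz).const_mul (2 * δ))).add_const
        (2 * δ ^ 2))).div ((hW.pow 2).const_mul 4) (mul_ne_zero (by norm_num) (pow_ne_zero 2 h1)))
    refine h.congr_deriv ?_
    simp
    field_simp
    linear_combination (4 * δ ^ 2 * w z ^ 4) * hyw z hz
  · have h0 := hw0 x hx
    have h1 := hwδ x hx
    field_simp
    ring

/-- An analytic function `f` that satisfies the equation wherever it does not vanish satisfies it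
everywhere. -/
lemma thirdOrder_of_ne_zero {f : ℂ → ℂ} {U : Set ℂ} (hU : IsOpen U)
    (hf : DifferentiableOn ℂ f U) {a b c : ℂ}
    (h : ∀ x ∈ U, f x ≠ 0 → f x * deriv (deriv (deriv f)) x - 3 * deriv f x * deriv (deriv f) x
      = a * deriv f x ^ 2 + b * f x * deriv f x + c * f x ^ 2) {x : ℂ} (hx : x ∈ U) :
    f x * deriv (deriv (deriv f)) x - 3 * deriv f x * deriv (deriv f) x
      = a * deriv f x ^ 2 + b * f x * deriv f x + c * f x ^ 2 := by
  have han : AnalyticAt ℂ f x := hf.analyticAt (hU.mem_nhds hx)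
  rcases han.eventually_eq_zero_or_eventually_ne_zero with h0 | h0
  · have h0' : f =ᶠ[𝓝 x] fun _ => 0 := h0
    have h1 : deriv f x = 0 := by simpa using h0'.deriv_eq
    simp [h0'.eq_of_nhds, h1]
  · have c0 := han.continuousAt
    have c1 := han.deriv.continuousAt
    have c2 := han.deriv.deriv.continuousAt
    have c3 := han.deriv.deriv.deriv.continuousAt
    have hl : ContinuousAt (fun z => f z * deriv (deriv (deriv f)) z
        - 3 * deriv f z * deriv (deriv f) z) x := by fun_prop
    have hr : ContinuousAt (fun z => a * deriv f z ^ 2 + b * f z * deriv f z + c * f z ^ 2) x := by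
      fun_prop
    refine tendsto_nhds_unique_of_eventuallyEq (hl.mono_left nhdsWithin_le_nhds)
      (hr.mono_left (nhdsWithin_le_nhds (s := {x}ᶜ))) ?_
    filter_upwards [h0, nhdsWithin_le_nhds (hU.mem_nhds hx)] with z hz hzU using h z hzU hz


/-- Assertion 1 of Section 8 of the paper (key step in Theorem 8 (thmain)):
the explicit expression (f4p) of the elliptic function of level 4 in terms of
the Weierstrass function `℘(x; g₂, g₃)` satisfies equation (feq) with
`C₁ = -6α`, `C₂ = 6(α² - β)`, `C₃ = 6α(5α² - 3β)`. -/
theorem elliptic_level4_assertion1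
    (α β g₂ g₃ c₁ c₂ c₃ c₄ : ℂ)
    (hg₂ : g₂ = -(13 * α ^ 4 - 6 * α ^ 2 * β - 3 * β ^ 2) / 4)
    (hg₃ : g₃ = (α ^ 2 - β) * (17 * α ^ 4 - 14 * α ^ 2 * β + β ^ 2) / 8)
    (hc₁ : c₁ = α ^ 2 - β)
    (hc₂ : c₂ = 51 * α ^ 4 / 8 - 21 * α ^ 2 * β / 4 + 3 * β ^ 2 / 8)
    (hc₃ : c₃ = -(α ^ 2 - β) * (47 * α ^ 4 - 34 * α ^ 2 * β - β ^ 2) / 16)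
    (hc₄ : c₄ = 545 * α ^ 8 / 256 - 295 * α ^ 6 * β / 64 + 435 * α ^ 4 * β ^ 2 / 128
      - 55 * α ^ 2 * β ^ 3 / 64 + β ^ 4 / 256)
    (U : Set ℂ) (hU : IsOpen U) (p : ℂ → ℂ)
    (hp : DifferentiableOn ℂ p U)
    (hp' : DifferentiableOn ℂ (deriv p) U)
    (hp'' : DifferentiableOn ℂ (deriv (deriv p)) U)
    (hweq : ∀ x ∈ U, (deriv p x) ^ 2 = 4 * p x ^ 3 - g₂ * p x - g₃)
    (hweq2 : ∀ x ∈ U, deriv (deriv p) x = 6 * p x ^ 2 - g₂ / 2)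
    (hden : ∀ x ∈ U, p x ^ 4 + c₁ * p x ^ 3 + c₂ * p x ^ 2 + c₃ * p x + c₄ ≠ 0)
    (f : ℂ → ℂ)
    (hf : ∀ x ∈ U, f x
      = (α * (4 * p x + 3 * α ^ 2 - β) * (2 * p x - α ^ 2 + β)
            * (4 * p x - 7 * α ^ 2 + 5 * β)
          - deriv p x * (4 * p x + 3 * α ^ 2 - β) ^ 2)
        / (32 * (p x ^ 4 + c₁ * p x ^ 3 + c₂ * p x ^ 2 + c₃ * p x + c₄))) :
    (DifferentiableOn ℂ f U ∧ DifferentiableOn ℂ (deriv f) U ∧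
      DifferentiableOn ℂ (deriv (deriv f)) U) ∧
    ∀ x ∈ U,
      f x * deriv (deriv (deriv f)) x - 3 * deriv f x * deriv (deriv f) x
        = -6 * α * (deriv f x) ^ 2 + 6 * (α ^ 2 - β) * f x * deriv f x
          + 6 * α * (5 * α ^ 2 - 3 * β) * (f x) ^ 2 := by
  have hfd : DifferentiableOn ℂ f U := by
    refine DifferentiableOn.congr (DifferentiableOn.div (by fun_prop) (by fun_prop) ?_) hf
    exact fun x hx => mul_ne_zero (by norm_num) (hden x hx)
  refine ⟨⟨hfd, hfd.deriv hU, (hfd.deriv hU).deriv hU⟩, fun x hx => ?_⟩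
  have hode := thirdOrder_of_ne_zero (a := -6 * α) (b := 2 * (5 * α ^ 2 - 3 * β) - 4 * α ^ 2)
    (c := 6 * α * (5 * α ^ 2 - 3 * β)) hU hfd ?_ hx
  · linear_combination hode
  intro t ht hft
  set V : Set ℂ := U ∩ f ⁻¹' {0}ᶜ
  have hV : IsOpen V := hfd.continuousOn.isOpen_inter_preimage hU isOpen_compl_singleton
  have hq : ∀ z ∈ V, (4 * deriv p z) ^ 2
      = (4 * p z + 3 * α ^ 2 - β - (5 * α ^ 2 - 3 * β)) * ((4 * p z + 3 * α ^ 2 - β) ^ 2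
        - 4 * α ^ 2 * (4 * p z + 3 * α ^ 2 - β - (5 * α ^ 2 - 3 * β))) := by
    intro z hz
    have := hweq z hz.1
    rw [hg₂, hg₃] at this
    linear_combination 16 * this
  have hw0 : ∀ z ∈ V, 4 * p z + 3 * α ^ 2 - β ≠ 0 := by
    intro z hz h0
    apply hz.2
    rw [Set.mem_singleton_iff, hf z hz.1, h0]
    simp
  have hwδ : ∀ z ∈ V, 4 * p z + 3 * α ^ 2 - β - (5 * α ^ 2 - 3 * β) ≠ 0 := by
    intro z hz h0
    have hq0 : deriv p z = 0 := by simpa [h0] using hq z hz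
    have hB : 2 * p z - α ^ 2 + β = 0 := by linear_combination h0 / 2
    apply hz.2
    rw [Set.mem_singleton_iff, hf z hz.1, hq0, hB]
    simp
  refine thirdOrder_of_quartic (w := fun z => 4 * p z + 3 * α ^ 2 - β)
    (y := fun z => 4 * deriv p z) (V := V) hV ?_ ?_ hq hw0 hwδ ?_ ⟨ht, hft⟩
  · intro z hz
    exact (((hp.differentiableAt (hU.mem_nhds hz.1)).hasDerivAt.const_mul 4).add_const
      (3 * α ^ 2)).sub_const β
  · intro z hz
    have h := (hp'.differentiableAt (hU.mem_nhds hz.1)).hasDerivAt.const_mul 4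
    refine h.congr_deriv ?_
    rw [hweq2 z hz.1, hg₂]
    ring
  · intro z hz
    have h0 := hw0 z hz
    have h1 := hwδ z hz
    have h2 := hden z hz.1
    have h3 := hweq z hz.1
    rw [hf z hz.1, hc₁, hc₂, hc₃, hc₄]
    rw [hc₁, hc₂, hc₃, hc₄] at h2
    rw [hg₂, hg₃] at h3
    generalize p z = P at *
    generalize deriv p z = q at *
    have hG : ∀ w W δ : ℂ, w ≠ 0 → W ≠ 0 → -α + 2 * α * δ / w - 4 * q / (2 * W)
        = -(α * W * (w - 2 * δ) + 2 * q * w) / (w * W) := by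
      intro w W δ hw hW
      field_simp
      ring
    rw [hG _ _ _ h0 h1, div_mul_div_comm,
      div_eq_one_iff_eq (mul_ne_zero (mul_ne_zero (by norm_num) h2) (mul_ne_zero h0 h1))]
    linear_combination 2 * (4 * P + 3 * α ^ 2 - β) ^ 3 * h3
end

section
/- Let α, β ∈ ℂ and set g₂ = −(13α⁴ − 6α²β − 3β²)/4, g₃ = (α² − β)(17α⁴ − 14α²β + β²)/8, c₁ = α² − β, c₂ = 51α⁴/8 − 21α²β/4 + 3β²/8, c₃ = −(α² − β)(47α⁴ − 34α²β − β²)/16, c₄ = 545α⁸/256 − 295α⁶β/64 + 435α⁴β²/128 − 55α²β³/64 + β⁴/256. Let U ⊆ ℂ be open and let p : ℂ → ℂ be twice differentiable on U with p'(x)² = 4p(x)³ − g₂·p(x) − g₃ and p''(x) = 6p(x)² − g₂/2 on U, and suppose p(x)⁴ + c₁p(x)³ + c₂p(x)² + c₃p(x) + c₄ ≠ 0 for all x ∈ U. Define f : U → ℂ by f(x) = [ α·(4p(x) + 3α² − β)(2p(x) − α² + β)(4p(x) − 7α² + 5β) − p'(x)·(4p(x) + 3α² − β)² ] / [ 32·(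 p(x)⁴ + c₁p(x)³ + c₂p(x)² + c₃p(x) + c₄ ) ]. Then for all x ∈ U: 4·(2f'(x) + 2α·f(x))² = ( 4f'(x)² − 2f(x)f''(x) − 4α·f(x)f'(x) − (14α² − 6β)·f(x)² ) · ( 2f'(x)² − f(x)f''(x) − 2α·f(x)f'(x) + (α² − 3β)·f(x)² )². -/
open Filter Topology

/-- The function `-1 / (a r + w)` satisfies the level 4 equation whenever `r` and `w` solve the system
`r' = w (1 - r²)`, `w' = r (w² + a²)` at the level `(1 - r²) (w² + a²) = 5a² - 3b`. -/
lemma level4_equation_of_system {a b : ℂ} {V : Set ℂ} (hV : IsOpen V) {r w f : ℂ → ℂ}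
    (hr : ∀ x ∈ V, HasDerivAt r (w x * (1 - r x ^ 2)) x)
    (hw : ∀ x ∈ V, HasDerivAt w (r x * (w x ^ 2 + a ^ 2)) x)
    (hs : ∀ x ∈ V, (1 - r x ^ 2) * (w x ^ 2 + a ^ 2) = 5 * a ^ 2 - 3 * b)
    (hne : ∀ x ∈ V, a * r x + w x ≠ 0)
    (hf : ∀ x ∈ V, f x = -(a * r x + w x)⁻¹) {x : ℂ} (hx : x ∈ V) :
    4 * (2 * deriv f x + 2 * a * f x) ^ 2
      = (4 * (deriv f x) ^ 2 - 2 * f x * deriv (deriv f) x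
          - 4 * a * f x * deriv f x - (14 * a ^ 2 - 6 * b) * (f x) ^ 2)
        * (2 * (deriv f x) ^ 2 - f x * deriv (deriv f) x
          - 2 * a * f x * deriv f x + (a ^ 2 - 3 * b) * (f x) ^ 2) ^ 2 := by
  have h1 : ∀ y ∈ V, deriv f y =
      (a * (w y * (1 - r y ^ 2)) + r y * (w y ^ 2 + a ^ 2)) / (a * r y + w y) ^ 2 := by
    intro y hy
    have hd := ((((hr y hy).const_mul a).add (hw y hy)).fun_inv (hne y hy)).neg
    have he : f =ᶠ[𝓝 y] -fun z => (a * r z + w z)⁻¹ :=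
      eventually_of_mem (hV.mem_nhds hy) hf
    rw [(hd.congr_of_eventuallyEq he).deriv]
    simp only [Pi.add_apply]
    ring
  have hrx := hr x hx
  have hwx := hw x hx
  have h2 := (((hwx.mul ((hrx.pow 2).const_sub 1)).const_mul a).add
    (hrx.mul ((hwx.pow 2).add_const (a ^ 2)))).div
    (((hrx.const_mul a).add hwx).pow 2) (pow_ne_zero 2 (hne x hx))
  have h2' := (h2.congr_of_eventuallyEq (eventually_of_mem (hV.mem_nhds hx) h1)).deriv
  have hb : b = (5 * a ^ 2 - (1 - r x ^ 2) * (w x ^ 2 + a ^ 2)) / 3 := by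
    rw [hs x hx]; ring
  have h0 := hne x hx
  rw [h2', h1 x hx, hf x hx, hb]
  simp only [Pi.add_apply, Pi.mul_apply, Pi.pow_apply]
  generalize r x = r at *
  generalize w x = w at *
  field_simp
  ring

/-- Assertion 3 of Section 8 of the paper (key step in Theorem 9 (Tmain)):
the explicit expression (f4p) of the elliptic function of level 4 in terms of
the Weierstrass function `℘(x; g₂, g₃)` satisfies equation (End):
`4(2f' + 2αf)² = (4f'² - 2ff'' - 4αff' - (14α² - 6β)f²)·(2f'² - ff'' - 2αff' + (α² - 3β)f²)²`. -/
theorem elliptic_level4_assertion3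
    (α β g₂ g₃ c₁ c₂ c₃ c₄ : ℂ)
    (hg₂ : g₂ = -(13 * α ^ 4 - 6 * α ^ 2 * β - 3 * β ^ 2) / 4)
    (hg₃ : g₃ = (α ^ 2 - β) * (17 * α ^ 4 - 14 * α ^ 2 * β + β ^ 2) / 8)
    (hc₁ : c₁ = α ^ 2 - β)
    (hc₂ : c₂ = 51 * α ^ 4 / 8 - 21 * α ^ 2 * β / 4 + 3 * β ^ 2 / 8)
    (hc₃ : c₃ = -(α ^ 2 - β) * (47 * α ^ 4 - 34 * α ^ 2 * β - β ^ 2) / 16)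
    (hc₄ : c₄ = 545 * α ^ 8 / 256 - 295 * α ^ 6 * β / 64 + 435 * α ^ 4 * β ^ 2 / 128
      - 55 * α ^ 2 * β ^ 3 / 64 + β ^ 4 / 256)
    (U : Set ℂ) (hU : IsOpen U) (p : ℂ → ℂ)
    (hp : DifferentiableOn ℂ p U)
    (hp' : DifferentiableOn ℂ (deriv p) U)
    (hweq : ∀ x ∈ U, (deriv p x) ^ 2 = 4 * p x ^ 3 - g₂ * p x - g₃)
    (hweq2 : ∀ x ∈ U, deriv (deriv p) x = 6 * p x ^ 2 - g₂ / 2)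
    (hden : ∀ x ∈ U, p x ^ 4 + c₁ * p x ^ 3 + c₂ * p x ^ 2 + c₃ * p x + c₄ ≠ 0)
    (f : ℂ → ℂ)
    (hf : ∀ x ∈ U, f x
      = (α * (4 * p x + 3 * α ^ 2 - β) * (2 * p x - α ^ 2 + β)
            * (4 * p x - 7 * α ^ 2 + 5 * β)
          - deriv p x * (4 * p x + 3 * α ^ 2 - β) ^ 2)
        / (32 * (p x ^ 4 + c₁ * p x ^ 3 + c₂ * p x ^ 2 + c₃ * p x + c₄))) :
    ∀ x ∈ U,
      4 * (2 * deriv f x + 2 * α * f x) ^ 2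
        = (4 * (deriv f x) ^ 2 - 2 * f x * deriv (deriv f) x
            - 4 * α * f x * deriv f x - (14 * α ^ 2 - 6 * β) * (f x) ^ 2)
          * (2 * (deriv f x) ^ 2 - f x * deriv (deriv f) x
            - 2 * α * f x * deriv f x + (α ^ 2 - 3 * β) * (f x) ^ 2) ^ 2 := by
  intro x hx
  subst hg₂ hg₃ hc₁ hc₂ hc₃ hc₄
  have hdp : ∀ y ∈ U, HasDerivAt p (deriv p y) y := fun y hy =>
    (hp.differentiableAt (hU.mem_nhds hy)).hasDerivAt
  have hdp' : ∀ y ∈ U, HasDerivAt (deriv p) _ y := fun y hy =>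
    hweq2 y hy ▸ (hp'.differentiableAt (hU.mem_nhds hy)).hasDerivAt
  have hL : ∀ y, HasDerivAt p (deriv p y) y →
      HasDerivAt (fun z => 4 * p z + 3 * α ^ 2 - β) (4 * deriv p y) y := fun y h =>
    ((h.const_mul 4).add_const _).sub_const _
  have hq : ∀ y, HasDerivAt p (deriv p y) y →
      HasDerivAt (fun z => 2 * p z - α ^ 2 + β) (2 * deriv p y) y := fun y h =>
    ((h.const_mul 2).sub_const _).add_const _
  have hn : ∀ y, HasDerivAt p (deriv p y) y →
      HasDerivAt (fun z => 4 * p z - 7 * α ^ 2 + 5 * β) (4 * deriv p y) y := fun y h =>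
    ((h.const_mul 4).sub_const _).add_const _
  by_cases hV : (4 * p x + 3 * α ^ 2 - β) * (2 * p x - α ^ 2 + β) = 0
  · -- At a zero of `f` the equation says `f' ^ 2 = f' ^ 6`.
    have hpx := hdp x hx
    have hD := hden x hx
    have hW := hweq x hx
    have hnum := (((hL x hpx).const_mul α).mul (hq x hpx)).mul (hn x hpx) |>.sub
      ((hdp' x hx).mul ((hL x hpx).pow 2))
    have hden' := (((((hpx.pow 4).add ((hpx.pow 3).const_mul (α ^ 2 - β))).add
      ((hpx.pow 2).const_mul (51 * α ^ 4 / 8 - 21 * α ^ 2 * β / 4 + 3 * β ^ 2 / 8))).add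
      (hpx.const_mul (-(α ^ 2 - β) * (47 * α ^ 4 - 34 * α ^ 2 * β - β ^ 2) / 16))).add_const
      (545 * α ^ 8 / 256 - 295 * α ^ 6 * β / 64 + 435 * α ^ 4 * β ^ 2 / 128
        - 55 * α ^ 2 * β ^ 3 / 64 + β ^ 4 / 256)).const_mul 32
    have hd := ((hnum.div hden' (mul_ne_zero (by norm_num) hD)).congr_of_eventuallyEq
      (eventually_of_mem (hU.mem_nhds hx) hf)).deriv
    simp only [Pi.add_apply, Pi.mul_apply, Pi.pow_apply, Pi.sub_apply] at hd
    have hfx := hf x hx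
    have hsq : f x = 0 ∧ (deriv f x ^ 2 = 1 ∨ deriv f x ^ 2 = -1) := by
      rw [hfx, hd]
      clear hd hfx hden' hnum hpx
      generalize p x = P at *
      generalize deriv p x = Y at *
      have hD4 := pow_ne_zero 2 (pow_ne_zero 2 (mul_ne_zero (by norm_num : (32 : ℂ) ≠ 0) hD))
      rcases mul_eq_zero.mp hV with h | h
      · obtain rfl : P = (β - 3 * α ^ 2) / 4 := by linear_combination h / 4
        refine ⟨by ring, Or.inr ?_⟩
        rw [div_pow, div_eq_iff hD4]
        linear_combination 64 * α ^ 6 * (5 * α ^ 2 - 3 * β) ^ 10 * hW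
      · obtain rfl : P = (α ^ 2 - β) / 2 := by linear_combination h / 2
        obtain rfl : Y = 0 := pow_eq_zero_iff two_ne_zero |>.mp (by rw [hW]; ring)
        refine ⟨by ring, Or.inl ?_⟩
        rw [div_pow, div_eq_iff hD4]
        ring
    obtain ⟨h0, h1 | h1⟩ := hsq
    · rw [h0]
      linear_combination (-16 * deriv f x ^ 2 * (deriv f x ^ 2 + 1)) * h1
    · rw [h0]
      linear_combination (-16 * deriv f x ^ 2 * (deriv f x ^ 2 - 1)) * h1
  · have hVo : IsOpen {y ∈ U | (4 * p y + 3 * α ^ 2 - β) * (2 * p y - α ^ 2 + β) ≠ 0} := by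
      have hc : ContinuousOn (fun y => (4 * p y + 3 * α ^ 2 - β) * (2 * p y - α ^ 2 + β)) U := by
        have := hp.continuousOn
        fun_prop
      exact hc.isOpen_inter_preimage hU isOpen_ne
    have key : ∀ y ∈ U,
        (α * (2 * p y - α ^ 2 + β) * (4 * p y - 7 * α ^ 2 + 5 * β)
            - deriv p y * (4 * p y + 3 * α ^ 2 - β)) *
          (α * (2 * p y - α ^ 2 + β) * (4 * p y - 7 * α ^ 2 + 5 * β)
            + deriv p y * (4 * p y + 3 * α ^ 2 - β)) =
        -32 * (2 * p y - α ^ 2 + β) * (p y ^ 4 + (α ^ 2 - β) * p y ^ 3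
          + (51 * α ^ 4 / 8 - 21 * α ^ 2 * β / 4 + 3 * β ^ 2 / 8) * p y ^ 2
          + (-(α ^ 2 - β) * (47 * α ^ 4 - 34 * α ^ 2 * β - β ^ 2) / 16) * p y
          + (545 * α ^ 8 / 256 - 295 * α ^ 6 * β / 64 + 435 * α ^ 4 * β ^ 2 / 128
            - 55 * α ^ 2 * β ^ 3 / 64 + β ^ 4 / 256)) := by
      intro y hy
      linear_combination -(4 * p y + 3 * α ^ 2 - β) ^ 2 * hweq y hy
    have hM : ∀ y ∈ U, 2 * p y - α ^ 2 + β ≠ 0 →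
        α * (2 * p y - α ^ 2 + β) * (4 * p y - 7 * α ^ 2 + 5 * β)
            + deriv p y * (4 * p y + 3 * α ^ 2 - β) ≠ 0 := by
      intro y hy h0 hM0
      have := key y hy
      rw [hM0, mul_zero] at this
      exact mul_ne_zero (mul_ne_zero (by norm_num) h0) (hden y hy) this.symm
    have hsum : ∀ y, (4 * p y + 3 * α ^ 2 - β) * (2 * p y - α ^ 2 + β) ≠ 0 →
        α * ((4 * p y - 7 * α ^ 2 + 5 * β) / (4 * p y + 3 * α ^ 2 - β))
          + deriv p y / (2 * p y - α ^ 2 + β) =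
        (α * (2 * p y - α ^ 2 + β) * (4 * p y - 7 * α ^ 2 + 5 * β)
            + deriv p y * (4 * p y + 3 * α ^ 2 - β)) /
          ((4 * p y + 3 * α ^ 2 - β) * (2 * p y - α ^ 2 + β)) := by
      intro y hy
      have hL0 := left_ne_zero_of_mul hy
      have hq0 := right_ne_zero_of_mul hy
      rw [← mul_div_assoc, div_add_div _ _ hL0 hq0]
      ring
    refine level4_equation_of_system hVo
      (r := fun y => (4 * p y - 7 * α ^ 2 + 5 * β) / (4 * p y + 3 * α ^ 2 - β))
      (w := fun y => deriv p y / (2 * p y - α ^ 2 + β)) ?_ ?_ ?_ ?_ ?_ ⟨hx, hV⟩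
    all_goals
      rintro y ⟨hy, hy0⟩
      have hL0 := left_ne_zero_of_mul hy0
      have hq0 := right_ne_zero_of_mul hy0
      have hW := hweq y hy
    · refine ((hn y (hdp y hy)).div (hL y (hdp y hy)) hL0).congr_deriv ?_
      generalize hLe : 4 * p y + 3 * α ^ 2 - β = L at *
      generalize hqe : 2 * p y - α ^ 2 + β = q at *
      field_simp
      subst hLe hqe
      ring
    · refine ((hdp' y hy).div (hq y (hdp y hy)) hq0).congr_deriv ?_
      generalize hLe : 4 * p y + 3 * α ^ 2 - β = L at *
      generalize hqe : 2 * p y - α ^ 2 + β = q at *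
      field_simp
      subst hLe hqe
      rw [hW]
      ring
    · simp only [div_pow, hW]
      generalize hLe : 4 * p y + 3 * α ^ 2 - β = L at *
      generalize hqe : 2 * p y - α ^ 2 + β = q at *
      field_simp
      subst hLe hqe
      ring
    · rw [hsum y hy0]
      exact div_ne_zero (hM y hy hq0) hy0
    · rw [hsum y hy0, hf y hy, inv_div, ← neg_div,
        div_eq_div_iff (mul_ne_zero (by norm_num) (hden y hy)) (hM y hy hq0)]
      linear_combination (4 * p y + 3 * α ^ 2 - β) * key y hy
end

section
/- Let α, γ ∈ ℂ and set g̃₂ = 4α(α³ − γ)/3 and g̃₃ = −(8α⁶ + 20α³γ − γ²)/27. Let U ⊆ ℂ be open and let p : ℂ → ℂ be three times differentiable on U with p'(x)² = 4p(x)³ − g̃₂·p(x) − g̃₃ and p''(x) = 6p(x)² − g̃₂/2 on U, and suppose 3p'(x) + 6α·p(x) − (2α³ + γ) ≠ 0 for all x ∈ U. Define f : U → ℂ by f(x) = −6·(p(x) + α²)/( 3p'(x) + 6α·p(x) − (2α³ + γ) ). Then f is three times differentiable on U and f(x)·f'''(x) − 3·f'(x)·f''(x) = −6α·f'(x)² −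 12α²·f(x)·f'(x) + (2γ + 16α³)·f(x)² for all x ∈ U. -/
open Polynomial

/-- The quotient rule for `(A(p) + q B(p)) / D ^ (k + 1)`. -/
theorem hasDerivAt_eval_add_mul_eval_div_pow (A B : ℂ[X]) {p q D : ℂ → ℂ} {p₂ D' m x : ℂ}
    (k : ℕ) (hp : HasDerivAt p (q x) x) (hq : HasDerivAt q p₂ x) (hD : HasDerivAt D D' x)
    (h0 : D x ≠ 0)
    (hm : (A.derivative.eval (p x) * q x
        + (p₂ * B.eval (p x) + q x * (B.derivative.eval (p x) * q x))) * D x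
      - (k + 1) * (A.eval (p x) + q x * B.eval (p x)) * D' = m) :
    HasDerivAt (fun y => (A.eval (p y) + q y * B.eval (p y)) / D y ^ (k + 1))
      (m / D x ^ (k + 2)) x := by
  have hA : HasDerivAt (fun y => A.eval (p y)) (A.derivative.eval (p x) * q x) x :=
    (A.hasDerivAt (p x)).comp x hp
  have hB : HasDerivAt (fun y => B.eval (p y)) (B.derivative.eval (p x) * q x) x :=
    (B.hasDerivAt (p x)).comp x hp
  refine ((hA.fun_add (hq.fun_mul hB)).fun_div (hD.fun_pow (k + 1))
    (pow_ne_zero _ h0)).congr_deriv ?_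
  subst hm
  simp only [Nat.add_sub_cancel]
  push_cast
  field_simp
  ring

theorem hasDerivAt_of_eqOn {g h : ℂ → ℂ} {U : Set ℂ} (hU : IsOpen U) (hgh : U.EqOn g h)
    {h' x : ℂ} (hx : x ∈ U) (hh : HasDerivAt h h' x) : HasDerivAt g h' x :=
  hh.congr_of_eventuallyEq (hgh.eventuallyEq_of_mem (hU.mem_nhds hx))

theorem level3_feq_of_numerators {n₀ n₁ n₂ n₃ d c₁ c₂ c₃ : ℂ} (hd : d ≠ 0)
    (h : n₀ * n₃ - 3 * n₁ * n₂
      = c₁ * n₁ ^ 2 * d - c₂ * n₀ * n₁ * d ^ 2 + c₃ * n₀ ^ 2 * d ^ 3) :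
    n₀ / d * (n₃ / d ^ 4) - 3 * (n₁ / d ^ 2) * (n₂ / d ^ 3)
      = c₁ * (n₁ / d ^ 2) ^ 2 - c₂ * (n₀ / d) * (n₁ / d ^ 2) + c₃ * (n₀ / d) ^ 2 := by
  have h5 : d ^ 5 ≠ 0 := pow_ne_zero 5 hd
  refine mul_right_cancel₀ h5 ?_
  field_simp
  linear_combination h

/-- The part of the numerator of the first derivative of `f` that is free of `deriv p`. -/
noncomputable def numerA1 (α γ : ℂ) : ℂ[X] :=
  C 36 * X ^ 3
    + C (108 * α ^ 2) * X ^ 2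
    + C (12 * α ^ 4 - 12 * α * γ) * X
    + C (-52 / 3 * α ^ 6 - 4 / 3 * α ^ 3 * γ + 2 / 3 * γ ^ 2)

/-- The part of the numerator of the first derivative of `f` that is linear in `deriv p`. -/
noncomputable def numerB1 (α γ : ℂ) : ℂ[X] :=
  C (48 * α ^ 3 + 6 * γ)

/-- The part of the numerator of the second derivative of `f` that is free of `deriv p`. -/
noncomputable def numerA2 (α γ : ℂ) : ℂ[X] :=
  C (-1296 * α ^ 2) * X ^ 4
    + C (-1152 * α ^ 4 + 504 * α * γ) * X ^ 3
    + C (-288 * α ^ 6 + 360 * α ^ 3 * γ - 72 * γ ^ 2) * X ^ 2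
    + C (768 * α ^ 8 - 24 * α ^ 5 * γ - 96 * α ^ 2 * γ ^ 2) * X
    + C (-496 / 3 * α ^ 10 - 392 * α ^ 7 * γ - 88 * α ^ 4 * γ ^ 2
      - 8 / 3 * α * γ ^ 3)

/-- The part of the numerator of the second derivative of `f` that is linear in `deriv p`. -/
noncomputable def numerB2 (α γ : ℂ) : ℂ[X] :=
  C (216 * α) * X ^ 3
    + C (-1080 * α ^ 3 - 216 * γ) * X ^ 2
    + C (-504 * α ^ 5 - 144 * α ^ 2 * γ) * X
    + C (280 * α ^ 7 - 56 * α ^ 4 * γ - 8 * α * γ ^ 2)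

/-- The part of the numerator of the third derivative of `f` that is free of `deriv p`. -/
noncomputable def numerA3 (α γ : ℂ) : ℂ[X] :=
  C (15552 * α ^ 2) * X ^ 6
    + C (-15552 * α * γ) * X ^ 5
    + C (57024 * α ^ 6 + 5184 * γ ^ 2) * X ^ 4
    + C (-32256 * α ^ 8 - 8064 * α ^ 5 * γ + 9216 * α ^ 2 * γ ^ 2) * X ^ 3
    + C (-8640 * α ^ 10 + 23040 * α ^ 7 * γ + 16128 * α ^ 4 * γ ^ 2
      + 576 * α * γ ^ 3) * X ^ 2
    + C (7680 * α ^ 12 + 576 * α ^ 9 * γ + 6912 * α ^ 6 * γ ^ 2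
      + 384 * α ^ 3 * γ ^ 3) * X
    + C (-3392 / 3 * α ^ 14 - 7168 / 3 * α ^ 11 * γ
      + 3008 * α ^ 8 * γ ^ 2 + 1472 / 3 * α ^ 5 * γ ^ 3 + 64 / 3 * α ^ 2 * γ ^ 4)

/-- The part of the numerator of the third derivative of `f` that is linear in `deriv p`. -/
noncomputable def numerB3 (α γ : ℂ) : ℂ[X] :=
  C (5184 * α ^ 3 + 2592 * γ) * X ^ 4
    + C (20736 * α ^ 5 + 10368 * α ^ 2 * γ) * X ^ 3
    + C (3456 * α ^ 7 - 1728 * α ^ 4 * γ - 1728 * α * γ ^ 2) * X ^ 2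
    + C (-9984 * α ^ 9 - 5760 * α ^ 6 * γ + 192 * γ ^ 3) * X
    + C (2112 * α ^ 11 + 3744 * α ^ 8 * γ + 1728 * α ^ 5 * γ ^ 2
      + 192 * α ^ 2 * γ ^ 3)

/-- Expression from the end of Section 6 of the paper: the elliptic function
of level 3, written as `f = -6(℘ + α²)/(3℘' + 6α℘ - (2α³ + γ))` in terms of
the Weierstrass function with invariants `g̃₂ = 4α(α³ - γ)/3`,
`g̃₃ = -(8α⁶ + 20α³γ - γ²)/27`, satisfies equation (feq):
`f f''' - 3 f' f'' = -6α (f')² - 12α² f f' + (2γ + 16α³) f²`. -/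
theorem elliptic_level3_weierstrass_feq
    (α γ : ℂ) (U : Set ℂ) (hU : IsOpen U) (p : ℂ → ℂ)
    (hp : DifferentiableOn ℂ p U)
    (hp' : DifferentiableOn ℂ (deriv p) U)
    (hp'' : DifferentiableOn ℂ (deriv (deriv p)) U)
    (hweq : ∀ x ∈ U, (deriv p x) ^ 2
      = 4 * p x ^ 3 - (4 * α * (α ^ 3 - γ) / 3) * p x
        - (-(8 * α ^ 6 + 20 * α ^ 3 * γ - γ ^ 2) / 27))
    (hweq2 : ∀ x ∈ U, deriv (deriv p) x = 6 * p x ^ 2 - (4 * α * (α ^ 3 - γ) / 3) / 2)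
    (hden : ∀ x ∈ U, 3 * deriv p x + 6 * α * p x - (2 * α ^ 3 + γ) ≠ 0)
    (f : ℂ → ℂ)
    (hf : ∀ x ∈ U, f x
      = -6 * (p x + α ^ 2) / (3 * deriv p x + 6 * α * p x - (2 * α ^ 3 + γ))) :
    (DifferentiableOn ℂ f U ∧ DifferentiableOn ℂ (deriv f) U ∧
      DifferentiableOn ℂ (deriv (deriv f)) U) ∧
    ∀ x ∈ U,
      f x * deriv (deriv (deriv f)) x - 3 * deriv f x * deriv (deriv f) x
        = -6 * α * (deriv f x) ^ 2 - 12 * α ^ 2 * f x * deriv f x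
          + (2 * γ + 16 * α ^ 3) * (f x) ^ 2 := by
  set q := deriv p
  set D : ℂ → ℂ := fun x => 3 * q x + 6 * α * p x - (2 * α ^ 3 + γ) with hD_def
  have hp_at : ∀ x ∈ U, HasDerivAt p (q x) x := fun x hx =>
    (hp.differentiableAt (hU.mem_nhds hx)).hasDerivAt
  have hq_at : ∀ x ∈ U, HasDerivAt q (6 * p x ^ 2 - (4 * α * (α ^ 3 - γ) / 3) / 2) x :=
    fun x hx => hweq2 x hx ▸ (hp'.differentiableAt (hU.mem_nhds hx)).hasDerivAt
  have hD_at : ∀ x ∈ U, HasDerivAt D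
      (3 * (6 * p x ^ 2 - (4 * α * (α ^ 3 - γ) / 3) / 2) + 6 * α * q x) x := fun x hx =>
    (((hq_at x hx).const_mul 3).add ((hp_at x hx).const_mul (6 * α))).sub_const _
  have f_eq : U.EqOn f fun x => ((C (-6) * X + C (-6 * α ^ 2)).eval (p x)
      + q x * (0 : ℂ[X]).eval (p x)) / D x ^ (0 + 1) := fun x hx => by
    simp only [hf x hx, hD_def, eval_add, eval_mul, eval_C, eval_X, eval_zero]
    ring
  have hasDeriv1 : ∀ x ∈ U, HasDerivAt f
      (((numerA1 α γ).eval (p x) + q x * (numerB1 α γ).eval (p x)) / D x ^ (0 + 2)) x := by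
    intro x hx
    refine hasDerivAt_of_eqOn hU f_eq hx (hasDerivAt_eval_add_mul_eval_div_pow _ _ 0
      (hp_at x hx) (hq_at x hx) (hD_at x hx) (hden x hx) ?_)
    simp only [numerA1, numerB1, hD_def, derivative_add, derivative_mul,
      derivative_C, derivative_X, derivative_zero, eval_add, eval_mul, eval_pow,
      eval_C, eval_X, eval_zero, eval_one]
    push_cast
    linear_combination (-18) * hweq x hx
  have deriv1_eq : U.EqOn (deriv f) fun x => ((numerA1 α γ).eval (p x)
      + q x * (numerB1 α γ).eval (p x)) / D x ^ (1 + 1) := fun x hx =>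
    (hasDeriv1 x hx).deriv
  have hasDeriv2 : ∀ x ∈ U, HasDerivAt (deriv f)
      (((numerA2 α γ).eval (p x) + q x * (numerB2 α γ).eval (p x)) / D x ^ (1 + 2)) x := by
    intro x hx
    refine hasDerivAt_of_eqOn hU deriv1_eq hx (hasDerivAt_eval_add_mul_eval_div_pow _ _ 1
      (hp_at x hx) (hq_at x hx) (hD_at x hx) (hden x hx) ?_)
    simp only [numerA1, numerB1, numerA2, numerB2, hD_def, derivative_add, derivative_mul,
      derivative_C, derivative_X, derivative_X_pow, eval_add, eval_mul, eval_pow,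
      eval_C, eval_X, eval_zero, eval_one]
    push_cast
    linear_combination (324 * p x ^ 2 + 648 * p x * α ^ 2 - 540 * α ^ 4 - 108 * α * γ) * hweq x hx
  have deriv2_eq : U.EqOn (deriv (deriv f)) fun x => ((numerA2 α γ).eval (p x)
      + q x * (numerB2 α γ).eval (p x)) / D x ^ (2 + 1) := fun x hx =>
    (hasDeriv2 x hx).deriv
  have hasDeriv3 : ∀ x ∈ U, HasDerivAt (deriv (deriv f))
      (((numerA3 α γ).eval (p x) + q x * (numerB3 α γ).eval (p x)) / D x ^ (2 + 2)) x := by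
    intro x hx
    refine hasDerivAt_of_eqOn hU deriv2_eq hx (hasDerivAt_eval_add_mul_eval_div_pow _ _ 2
      (hp_at x hx) (hq_at x hx) (hD_at x hx) (hden x hx) ?_)
    simp only [numerA2, numerB2, numerA3, numerB3, hD_def, derivative_add, derivative_mul,
      derivative_C, derivative_X, derivative_X_pow, eval_add, eval_mul, eval_pow,
      eval_C, eval_X, eval_zero, eval_one]
    push_cast
    linear_combination (1944 * q x * p x ^ 2 * α - 6480 * q x * p x * α ^ 3
      - 1296 * q x * p x * γ - 1512 * q x * α ^ 5 - 432 * q x * α ^ 2 * γ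
      - 15552 * p x ^ 3 * α ^ 2 - 5184 * p x ^ 2 * α ^ 4 + 5184 * p x ^ 2 * α * γ
      + 8640 * p x * α ^ 6 + 6912 * p x * α ^ 3 * γ - 1728 * α ^ 8 + 1728 * α ^ 5 * γ) * hweq x hx
  have deriv3_eq : U.EqOn (deriv (deriv (deriv f))) fun x => ((numerA3 α γ).eval (p x)
      + q x * (numerB3 α γ).eval (p x)) / D x ^ (3 + 1) := fun x hx =>
    (hasDeriv3 x hx).deriv
  refine ⟨⟨fun x hx => (hasDeriv1 x hx).differentiableAt.differentiableWithinAt,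
    fun x hx => (hasDeriv2 x hx).differentiableAt.differentiableWithinAt,
    fun x hx => (hasDeriv3 x hx).differentiableAt.differentiableWithinAt⟩, fun x hx => ?_⟩
  rw [deriv1_eq hx, deriv2_eq hx, deriv3_eq hx, hf x hx]
  refine level3_feq_of_numerators (hden x hx) ?_
  simp only [numerA1, numerB1, numerA2, numerB2, numerA3, numerB3, eval_add, eval_mul,
    eval_pow, eval_C, eval_X]
  linear_combination (-15552 * q x * p x ^ 2 * α ^ 3 - 1944 * q x * p x ^ 2 * γ
    - 62208 * q x * p x * α ^ 5 - 7776 * q x * p x * α ^ 2 * γ - 5184 * q x * α ^ 7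
    + 4536 * q x * α ^ 4 * γ + 648 * q x * α * γ ^ 2 - 23328 * p x ^ 4 * α ^ 2
    - 155520 * p x ^ 3 * α ^ 4 - 7776 * p x ^ 3 * α * γ - 15552 * p x ^ 2 * α ^ 6
    + 62208 * p x ^ 2 * α ^ 3 * γ + 5832 * p x ^ 2 * γ ^ 2 + 65664 * p x * α ^ 8
    + 78624 * p x * α ^ 5 * γ + 7344 * p x * α ^ 2 * γ ^ 2 - 14112 * α ^ 10
    + 22464 * α ^ 7 * γ + 3240 * α ^ 4 * γ ^ 2 + 72 * α * γ ^ 3) * hweq x hx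
end
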